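/- Let K be an algebraically closed field of characteristic zero and let f1, f2, f3 be homogeneous polynomials of positive degree in R = K[X,Y,Z] such that the ideal I = (f1,f2,f3) is R_+-primary (equivalently, R/I is Artinian; i.e. f1,f2,f3 form an Artinian complete intersection). Then the Artinian algebra A = R/(f1,f2,f3) has the Weak Lefschetz property: there exists a linear form ℓ ∈ R_1 such that for every m ≥ 0 the multiplication map μ_ℓ : A_m → A_{m+1} is injective or surjective. -/

import Mathlib

open MvPolynomial

/-- The multiplication map `μ_ℓ : A_m → A_{m+1}` on `A = R/I` (with `R = K[X,Y,Z]`)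
induced by a linear form `ℓ` is injective: expressed on representatives, every
homogeneous polynomial `h` of degree `m` with `ℓ * h ∈ I` lies in `I`. -/
def LefInj {K : Type*} [Field K] (I : Ideal (MvPolynomial (Fin 3) K))
    (ℓ : MvPolynomial (Fin 3) K) (m : ℕ) : Prop :=
  ∀ h : MvPolynomial (Fin 3) K, h.IsHomogeneous m → ℓ * h ∈ I → h ∈ I

/-- The multiplication map `μ_ℓ : A_m → A_{m+1}` on `A = R/I` is surjective:
every class of a homogeneous polynomial `g` of degree `m+1` is the class of
`ℓ * h` for some homogeneous `h` of degree `m`. -/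
def LefSurj {K : Type*} [Field K] (I : Ideal (MvPolynomial (Fin 3) K))
    (ℓ : MvPolynomial (Fin 3) K) (m : ℕ) : Prop :=
  ∀ g : MvPolynomial (Fin 3) K, g.IsHomogeneous (m + 1) →
    ∃ h : MvPolynomial (Fin 3) K, h.IsHomogeneous m ∧ g - ℓ * h ∈ I

/-- The Artinian algebra `A = R/I` has the Weak Lefschetz property: there is a
(nonzero) linear form `ℓ ∈ R_1` such that `μ_ℓ : A_m → A_{m+1}` is injective or
surjective for every `m ≥ 0`. -/
def WeakLefschetz {K : Type*} [Field K] (I : Ideal (MvPolynomial (Fin 3) K)) : Prop :=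
  ∃ ℓ : MvPolynomial (Fin 3) K, ℓ ≠ 0 ∧ ℓ.IsHomogeneous 1 ∧
    ∀ m : ℕ, LefInj I ℓ m ∨ LefSurj I ℓ m

/-- A homogeneous polynomial of degree `n` evaluated at a scaled point. -/
lemma aeval_mul_left_of_isHomogeneous {K σ A : Type*} [CommSemiring K] [CommSemiring A]
    [Algebra K A] {F : MvPolynomial σ K} {n : ℕ} (hF : F.IsHomogeneous n) (c : A) (v : σ → A) :
    aeval (fun j => c * v j) F = c ^ n * aeval v F := by
  rw [aeval_def, aeval_def, eval₂_eq, eval₂_eq, Finset.mul_sum]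
  refine Finset.sum_congr rfl fun m hm => ?_
  have hdeg : ∑ i ∈ m.support, m i = n := (hF.degree_eq_sum_deg_support hm).symm
  simp_rw [mul_pow, Finset.prod_mul_distrib, Finset.prod_pow_eq_pow_sum, hdeg]
  ring

lemma eq_zero_of_forall_eval_of_apply_eq_one {K σ : Type*} [Field K]
    [Infinite K] {F : MvPolynomial σ K} {n : ℕ} (hF : F.IsHomogeneous n) (i : σ)
    (h : ∀ p : σ → K, p i = 1 → eval p F = 0) : F = 0 := by
  have hmul : X i * F = 0 := by
    apply MvPolynomial.funext
    intro p
    by_cases hp : p i = 0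
    · simp [hp]
    · have h1 := aeval_mul_left_of_isHomogeneous hF (p i) (fun j => (p i)⁻¹ * p j)
      have h2 : (fun j => p i * ((p i)⁻¹ * p j)) = p := by
        funext j; field_simp
      rw [h2] at h1
      have h3 := h (fun j => (p i)⁻¹ * p j) (by field_simp)
      have h4 : eval p F = 0 := by
        rw [← coe_aeval_eq_eval]
        refine h1.trans ?_
        rw [show (aeval fun j => (p i)⁻¹ * p j) F = eval (fun j => (p i)⁻¹ * p j) F from
          DFunLike.congr_fun (coe_aeval_eq_eval _) F, h3, mul_zero]
      simp [h4]
  exact (mul_eq_zero.mp hmul).resolve_left (X_ne_zero i)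

section Primary

variable {K : Type*} [Field K]

lemma MvPolynomial.span_X_eq_ker_constantCoeff :
    (Ideal.span {X 0, X 1, X 2} : Ideal (MvPolynomial (Fin 3) K)) =
      RingHom.ker (constantCoeff : MvPolynomial (Fin 3) K →+* K) := by
  apply le_antisymm
  · rw [Ideal.span_le]
    rintro _ (rfl | rfl | rfl) <;> simp [RingHom.mem_ker]
  · intro p hp
    have key : ∀ p : MvPolynomial (Fin 3) K,
        p - C (constantCoeff p) ∈ (Ideal.span {X 0, X 1, X 2} : Ideal (MvPolynomial (Fin 3) K)) := by
      intro p
      induction p using MvPolynomial.induction_on with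
      | C a => simp
      | add p q hp hq =>
        have := Ideal.add_mem _ hp hq
        convert this using 1
        simp only [map_add]; ring
      | mul_X p i _ =>
        have : (X i : MvPolynomial (Fin 3) K) ∈ (Ideal.span {X 0, X 1, X 2} : Ideal _) := by
          apply Ideal.subset_span
          fin_cases i <;> simp
        simpa using Ideal.mul_mem_left _ p this
    have := key p
    rw [RingHom.mem_ker] at hp
    simpa [hp] using this

lemma ker_constantCoeff_mem_minimalPrimes {I J : Ideal (MvPolynomial (Fin 3) K)}
    (hI : I.radical = RingHom.ker (constantCoeff : MvPolynomial (Fin 3) K →+* K))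
    (hJ : J ≤ RingHom.ker (constantCoeff : MvPolynomial (Fin 3) K →+* K)) (hIJ : I ≤ J) :
    RingHom.ker (constantCoeff : MvPolynomial (Fin 3) K →+* K) ∈ J.minimalPrimes := by
  refine ⟨⟨RingHom.ker_isPrime _, hJ⟩, fun Q hQ _ => ?_⟩
  rw [← hI]
  exact hQ.1.radical_le_iff.mpr (hIJ.trans hQ.2)

lemma not_prime_chain_of_radical_eq {f : Fin 3 → MvPolynomial (Fin 3) K}
    (hI : (Ideal.span (Set.range f)).radical =
      RingHom.ker (constantCoeff : MvPolynomial (Fin 3) K →+* K))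
    (P Q : Ideal (MvPolynomial (Fin 3) K)) [P.IsPrime] [Q.IsPrime]
    (h0 : f 0 ∈ P) (h1 : f 1 ∈ P) (hPQ : P < Q)
    (hQ : Q < RingHom.ker (constantCoeff : MvPolynomial (Fin 3) K →+* K)) : False := by
  set M := RingHom.ker (constantCoeff : MvPolynomial (Fin 3) K →+* K) with hM
  have hMp : M.IsPrime := RingHom.ker_isPrime _
  have hIM : Ideal.span (Set.range f) ≤ M := hI ▸ Ideal.le_radical
  have hmin : M ∈ (P ⊔ Ideal.span {f 2}).minimalPrimes := by
    apply ker_constantCoeff_mem_minimalPrimes hI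
    · refine sup_le (hPQ.le.trans hQ.le) ?_
      rw [Ideal.span_singleton_le_iff_mem]
      exact hIM (Ideal.subset_span ⟨2, rfl⟩)
    · rw [Ideal.span_le]
      rintro _ ⟨i, rfl⟩
      fin_cases i
      · exact Ideal.mem_sup_left h0
      · exact Ideal.mem_sup_left h1
      · exact Ideal.mem_sup_right (Ideal.mem_span_singleton_self _)
  have hle := Ideal.map_height_le_one_of_mem_minimalPrimes hmin
  have hker : RingHom.ker (Ideal.Quotient.mk P) = P := Ideal.mk_ker
  have hcomap : ∀ J : Ideal (MvPolynomial (Fin 3) K), P ≤ J →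
      (J.map (Ideal.Quotient.mk P)).comap (Ideal.Quotient.mk P) = J := by
    intro J hJ
    rw [Ideal.comap_map_of_surjective' _ Ideal.Quotient.mk_surjective, hker]
    exact sup_eq_left.mpr hJ
  have hmapprime : ∀ J : Ideal (MvPolynomial (Fin 3) K), P ≤ J → J.IsPrime →
      (J.map (Ideal.Quotient.mk P)).IsPrime := fun J hJ hJp =>
    Ideal.map_isPrime_of_surjective Ideal.Quotient.mk_surjective (hker.trans_le hJ)
  have hmono : ∀ J J' : Ideal (MvPolynomial (Fin 3) K), P ≤ J → P ≤ J' → J < J' →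
      J.map (Ideal.Quotient.mk P) < J'.map (Ideal.Quotient.mk P) := by
    intro J J' hJ hJ' hlt
    refine lt_of_le_of_ne (Ideal.map_mono hlt.le) fun he => hlt.ne ?_
    rw [← hcomap J hJ, ← hcomap J' hJ', he]
  have i0 := hmapprime P le_rfl inferInstance
  have i1 := hmapprime Q hPQ.le inferInstance
  have i2 := hmapprime M (hPQ.le.trans hQ.le) hMp
  have e1 := Ideal.height_add_one_le_of_lt_of_isPrime (hmono P Q le_rfl hPQ.le hPQ)
  have e2 := Ideal.height_add_one_le_of_lt_of_isPrime
    (hmono Q M hPQ.le (hPQ.le.trans hQ.le) hQ)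
  have e3 : (1 : ℕ∞) + 1 ≤ 1 := by
    calc (1 : ℕ∞) + 1 ≤ (Q.map (Ideal.Quotient.mk P)).height + 1 := by
          gcongr
          exact le_trans le_add_self e1
      _ ≤ _ := e2.trans hle
  exact absurd e3 (by decide)

lemma three_le_height_ker_constantCoeff :
    3 ≤ (RingHom.ker (constantCoeff : MvPolynomial (Fin 3) K →+* K)).height := by
  let φ : MvPolynomial (Fin 3) K →ₐ[K] MvPolynomial (Fin 3) K := aeval ![0, X 1, X 2]
  let ψ : MvPolynomial (Fin 3) K →ₐ[K] MvPolynomial (Fin 3) K := aeval ![0, 0, X 2]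
  have hψφ : ψ.comp φ = ψ := by
    ext i; fin_cases i <;> simp [φ, ψ]
  have hcψ : (constantCoeff : MvPolynomial (Fin 3) K →+* K).comp
      (ψ : MvPolynomial (Fin 3) K →+* MvPolynomial (Fin 3) K) =
      constantCoeff := by
    ext i
    · simp
    · fin_cases i <;> simp [ψ]
  have p1 : (RingHom.ker φ).IsPrime := RingHom.ker_isPrime _
  have p2 : (RingHom.ker ψ).IsPrime := RingHom.ker_isPrime _
  have p3 : (RingHom.ker (constantCoeff : MvPolynomial (Fin 3) K →+* K)).IsPrime :=
    RingHom.ker_isPrime _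
  have l1 : (⊥ : Ideal (MvPolynomial (Fin 3) K)) < RingHom.ker φ := by
    rw [bot_lt_iff_ne_bot, Submodule.ne_bot_iff]
    exact ⟨X 0, by simp [RingHom.mem_ker, φ], X_ne_zero _⟩
  have l2 : RingHom.ker φ < RingHom.ker ψ := by
    refine SetLike.lt_iff_le_and_exists.mpr ⟨fun x hx => ?_, X 1, by simp [RingHom.mem_ker, ψ],
      by simp [RingHom.mem_ker, φ, X_ne_zero]⟩
    rw [RingHom.mem_ker] at hx ⊢
    rw [← hψφ, AlgHom.comp_apply, hx, map_zero]
  have l3 : RingHom.ker ψ < RingHom.ker (constantCoeff : MvPolynomial (Fin 3) K →+* K) := by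
    refine SetLike.lt_iff_le_and_exists.mpr ⟨fun x hx => ?_, X 2, by simp [RingHom.mem_ker],
      by simp [RingHom.mem_ker, ψ, X_ne_zero]⟩
    rw [RingHom.mem_ker] at hx ⊢
    rw [← hcψ, RingHom.comp_apply, RingHom.coe_coe, hx, map_zero]
  have e1 := Ideal.height_add_one_le_of_lt_of_isPrime l1
  have e2 := Ideal.height_add_one_le_of_lt_of_isPrime l2
  have e3 := Ideal.height_add_one_le_of_lt_of_isPrime l3
  calc (3 : ℕ∞) = 0 + 1 + 1 + 1 := by norm_num
    _ ≤ (⊥ : Ideal (MvPolynomial (Fin 3) K)).height + 1 + 1 + 1 := by gcongr; exact zero_le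
    _ ≤ (RingHom.ker φ).height + 1 + 1 := by gcongr
    _ ≤ (RingHom.ker ψ).height + 1 := by gcongr
    _ ≤ _ := e3

lemma ne_zero_of_radical_span_range_eq {f : Fin 3 → MvPolynomial (Fin 3) K}
    (hI : (Ideal.span (Set.range f)).radical =
      RingHom.ker (constantCoeff : MvPolynomial (Fin 3) K →+* K)) : f 0 ≠ 0 := by
  intro h0
  have hmin := ker_constantCoeff_mem_minimalPrimes hI (J := Ideal.span {f 1, f 2})
    (by
      rw [← hI]
      refine le_trans (Ideal.span_mono ?_) Ideal.le_radical
      rintro _ (rfl | rfl) <;> simp)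
    (by
      rw [Ideal.span_le]
      rintro _ ⟨i, rfl⟩
      fin_cases i
      · simp [h0]
      · exact Ideal.subset_span (by simp)
      · exact Ideal.subset_span (by simp))
  have h := Ideal.height_le_card_of_mem_minimalPrimes_span (Set.toFinite _) hmin
  have h2 := (three_le_height_ker_constantCoeff (K := K)).trans h
  have h3 : ({f 1, f 2} : Set (MvPolynomial (Fin 3) K)).ncard ≤ 2 :=
    (Set.ncard_insert_le _ _).trans (by simp)
  have h4 : 3 ≤ ({f 1, f 2} : Set (MvPolynomial (Fin 3) K)).ncard := by exact_mod_cast h2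
  omega

end Primary

section Homogeneous

variable {K : Type*} [Field K]

/-- Dehomogenization with respect to the second variable. -/
noncomputable def dehom (K : Type*) [Field K] :
    MvPolynomial (Fin 3) K →ₐ[K] MvPolynomial (Fin 2) K :=
  aeval ![X 0, 1, X 1]

/-- Dehomogenization after restriction to the line `X 2 = a * X 0 + b * X 1`. -/
noncomputable def res {K : Type*} [Field K] (a b : K) :
    MvPolynomial (Fin 3) K →ₐ[K] Polynomial K :=
  aeval ![Polynomial.X, 1, Polynomial.C a * Polynomial.X + Polynomial.C b]

/-- Dehomogenization after restriction to the generic line `X 2 = u * X 0 + v * X 1`. -/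
noncomputable def gen (K : Type*) [Field K] :
    MvPolynomial (Fin 3) K →ₐ[K] Polynomial (MvPolynomial (Fin 2) K) :=
  aeval ![Polynomial.X, 1, Polynomial.C (X 0) * Polynomial.X + Polynomial.C (X 1)]

/-- The linear form whose zero locus is the line `X 2 = a * X 0 + b * X 1`. -/
noncomputable def lin {K : Type*} [Field K] (a b : K) : MvPolynomial (Fin 3) K :=
  X 2 - C a * X 0 - C b * X 1

lemma isHomogeneous_lin (a b : K) : (lin a b).IsHomogeneous 1 := by
  have h : ∀ (c : K) (i : Fin 3), (C c * X i : MvPolynomial (Fin 3) K).IsHomogeneous 1 :=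
    fun c i => by simpa using (isHomogeneous_C (Fin 3) c).mul (isHomogeneous_X K i)
  exact ((isHomogeneous_X K 2).sub (h a 0)).sub (h b 1)

lemma lin_ne_zero (a b : K) : lin a b ≠ 0 := by
  intro h
  have := congrArg (eval ![0, 0, 1]) h
  simp [lin] at this

lemma res_lin (a b : K) : res a b (lin a b) = 0 := by
  simp only [res, lin, map_sub, map_mul, aeval_X, algHom_C]
  simp [Polynomial.C_eq_algebraMap]

lemma map_gen (a b : K) (F : MvPolynomial (Fin 3) K) :
    (gen K F).map (eval ![a, b]) = res a b F := by
  have h : ((Polynomial.mapRingHom (eval ![a, b])).comp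
      (gen K : MvPolynomial (Fin 3) K →+* Polynomial (MvPolynomial (Fin 2) K))) =
      (res a b : MvPolynomial (Fin 3) K →+* Polynomial K) := by
    ext i
    · simp [gen, res, Polynomial.coeff_C]
    · fin_cases i <;> simp [gen, res]
  exact DFunLike.congr_fun h F

lemma natDegree_aeval_le_of_isHomogeneous {S : Type*} [CommRing S] [Algebra K S]
    {F : MvPolynomial (Fin 3) K} {n : ℕ} (hF : F.IsHomogeneous n) (v : Fin 3 → Polynomial S)
    (hv : ∀ i, (v i).natDegree ≤ 1) : (aeval v F).natDegree ≤ n := by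
  rw [aeval_def, eval₂_eq]
  refine Polynomial.natDegree_sum_le_of_forall_le _ _ fun m hm => ?_
  refine Polynomial.natDegree_mul_le.trans ?_
  have hdeg : ∑ i ∈ m.support, m i = n := (hF.degree_eq_sum_deg_support hm).symm
  rw [IsScalarTower.algebraMap_apply K S (Polynomial S), Polynomial.algebraMap_eq,
    Polynomial.natDegree_C, zero_add, ← hdeg]
  refine (Polynomial.natDegree_prod_le _ _).trans (Finset.sum_le_sum fun i _ => ?_)
  refine Polynomial.natDegree_pow_le.trans ?_
  calc m i * (v i).natDegree ≤ m i * 1 := Nat.mul_le_mul_left _ (hv i)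
    _ = m i := mul_one _

lemma natDegree_res_le {F : MvPolynomial (Fin 3) K} {n : ℕ} (hF : F.IsHomogeneous n) (a b : K) :
    (res a b F).natDegree ≤ n := by
  refine natDegree_aeval_le_of_isHomogeneous hF _ fun i => ?_
  fin_cases i
  · simp
  · simp
  · exact Polynomial.natDegree_linear_le

lemma natDegree_gen_le {F : MvPolynomial (Fin 3) K} {n : ℕ} (hF : F.IsHomogeneous n) :
    (gen K F).natDegree ≤ n := by
  refine natDegree_aeval_le_of_isHomogeneous hF _ fun i => ?_
  fin_cases i
  · simp
  · simp
  · exact Polynomial.natDegree_linear_le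

lemma exists_isHomogeneous_res_eq (a b : K) (p : Polynomial K) {k : ℕ} (hp : p.natDegree ≤ k) :
    ∃ H : MvPolynomial (Fin 3) K, H.IsHomogeneous k ∧ res a b H = p := by
  refine ⟨∑ j ∈ Finset.range (k + 1), C (p.coeff j) * (X 0 ^ j * X 1 ^ (k - j)), ?_, ?_⟩
  · refine IsHomogeneous.sum _ _ _ fun j hj => ?_
    have hj' : j ≤ k := Nat.lt_succ_iff.mp (Finset.mem_range.mp hj)
    have h1 := (isHomogeneous_C (Fin 3) (p.coeff j)).mul
      (((isHomogeneous_X K (0 : Fin 3)).pow j).mul ((isHomogeneous_X K (1 : Fin 3)).pow (k - j)))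
    convert h1 using 1
    omega
  · rw [map_sum]
    conv_rhs => rw [Polynomial.as_sum_range_C_mul_X_pow' p (Nat.lt_succ_of_le hp)]
    refine Finset.sum_congr rfl fun j _ => ?_
    simp [res, Polynomial.C_eq_algebraMap]

lemma dehom_eq_zero [Infinite K] {F : MvPolynomial (Fin 3) K} {n : ℕ} (hF : F.IsHomogeneous n)
    (h : dehom K F = 0) : F = 0 := by
  refine eq_zero_of_forall_eval_of_apply_eq_one hF 1 fun p hp => ?_
  have h1 : (eval ![p 0, p 2]).comp (dehom K : MvPolynomial (Fin 3) K →+* MvPolynomial (Fin 2) K) =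
      eval p := by
    ext i
    · simp
    · fin_cases i <;> simp [dehom, hp]
  rw [← h1, RingHom.comp_apply, RingHom.coe_coe, h, map_zero]

lemma exists_isHomogeneous_dehom_eq (G : MvPolynomial (Fin 2) K) {k : ℕ} (hG : G.totalDegree ≤ k) :
    ∃ H : MvPolynomial (Fin 3) K, H.IsHomogeneous k ∧ dehom K H = G := by
  refine ⟨∑ m ∈ G.support, C (coeff m G) * (X 0 ^ m 0 * X 1 ^ (k - (m 0 + m 1)) * X 2 ^ m 1),
    ?_, ?_⟩
  · refine IsHomogeneous.sum _ _ _ fun m hm => ?_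
    have hm' : m 0 + m 1 ≤ k := by
      have := (le_totalDegree hm).trans hG
      rwa [Finsupp.sum_fintype _ _ (fun _ => rfl), Fin.sum_univ_two] at this
    have h1 := (isHomogeneous_C (Fin 3) (coeff m G)).mul
      ((((isHomogeneous_X K (0 : Fin 3)).pow (m 0)).mul
        ((isHomogeneous_X K (1 : Fin 3)).pow (k - (m 0 + m 1)))).mul
        ((isHomogeneous_X K (2 : Fin 3)).pow (m 1)))
    convert h1 using 1
    omega
  · rw [map_sum]
    conv_rhs => rw [G.as_sum]
    refine Finset.sum_congr rfl fun m _ => ?_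
    rw [monomial_eq, Finsupp.prod_fintype _ _ (fun _ => pow_zero _), Fin.prod_univ_two]
    simp [dehom]

lemma homogeneousComponent_mul_of_lt {σ : Type*} {F : MvPolynomial σ K} {m n : ℕ}
    (hF : F.IsHomogeneous m) (G : MvPolynomial σ K) (h : n < m) :
    homogeneousComponent n (F * G) = 0 := by
  classical
  conv_lhs => rw [← G.sum_homogeneousComponent]
  rw [Finset.mul_sum, map_sum]
  refine Finset.sum_eq_zero fun i _ => ?_
  rw [homogeneousComponent_of_mem (hF.mul (homogeneousComponent_isHomogeneous i G)),
    if_neg (by omega)]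

lemma homogeneousComponent_mul_add {σ : Type*} {F : MvPolynomial σ K} {m : ℕ}
    (hF : F.IsHomogeneous m) (G : MvPolynomial σ K) (n : ℕ) :
    homogeneousComponent (m + n) (F * G) = F * homogeneousComponent n G := by
  classical
  conv_lhs => rw [← G.sum_homogeneousComponent]
  rw [Finset.mul_sum, map_sum]
  have : ∀ i, homogeneousComponent (m + n) (F * homogeneousComponent i G) =
      if i = n then F * homogeneousComponent n G else 0 := by
    intro i
    rw [homogeneousComponent_of_mem (hF.mul (homogeneousComponent_isHomogeneous i G))]
    split_ifs with h1 h2 h2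
    · rw [h2]
    · omega
    · omega
    · rfl
  simp_rw [this]
  rw [Finset.sum_ite_eq']
  split_ifs with h
  · rfl
  · rw [homogeneousComponent_eq_zero, mul_zero]
    simpa using h

lemma exists_isHomogeneous_mul_of_mul {σ : Type*} {F H : MvPolynomial σ K} {m n : ℕ}
    (hF : F.IsHomogeneous m) (hH : H.IsHomogeneous (m + n)) (h : F ∣ H) :
    ∃ G : MvPolynomial σ K, G.IsHomogeneous n ∧ H = F * G := by
  obtain ⟨G, rfl⟩ := h
  refine ⟨homogeneousComponent n G, homogeneousComponent_isHomogeneous n G, ?_⟩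
  rw [← homogeneousComponent_mul_add hF, homogeneousComponent_of_mem hH, if_pos rfl]

lemma lin_dvd_of_res_eq_zero [Infinite K] {H : MvPolynomial (Fin 3) K} {n : ℕ}
    (hH : H.IsHomogeneous n) {a b : K} (h : res a b H = 0) : lin a b ∣ H := by
  let ρ : MvPolynomial (Fin 3) K →ₐ[K] MvPolynomial (Fin 3) K :=
    aeval ![X 0, X 1, C a * X 0 + C b * X 1]
  have hlin : ∀ (c : K) (i : Fin 3), (C c * X i : MvPolynomial (Fin 3) K).IsHomogeneous 1 :=
    fun c i => by simpa using (isHomogeneous_C (Fin 3) c).mul (isHomogeneous_X K i)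
  have hρH : (ρ H).IsHomogeneous n := by
    have := IsHomogeneous.aeval (n := 1) hH
      (![X 0, X 1, C a * X 0 + C b * X 1] : Fin 3 → MvPolynomial (Fin 3) K) (by
      intro i
      fin_cases i
      · exact isHomogeneous_X K 0
      · exact isHomogeneous_X K 1
      · simpa using (hlin a 0).add (hlin b 1))
    rwa [one_mul] at this
  have hρ0 : ρ H = 0 := by
    refine eq_zero_of_forall_eval_of_apply_eq_one hρH 1 fun p hp => ?_
    have h1 : (eval p).comp (ρ : MvPolynomial (Fin 3) K →+* MvPolynomial (Fin 3) K) =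
        (Polynomial.evalRingHom (p 0)).comp
          (res a b : MvPolynomial (Fin 3) K →+* Polynomial K) := by
      ext i
      · simp [ρ]
      · fin_cases i <;> simp [ρ, res, hp]
    have h2 := DFunLike.congr_fun h1 H
    simpa [h] using h2
  have hq : (Ideal.Quotient.mkₐ K (Ideal.span {lin a b})).comp ρ =
      Ideal.Quotient.mkₐ K (Ideal.span {lin a b}) := by
    ext i
    fin_cases i
    · simp [ρ]
    · simp [ρ]
    · simp only [ρ, AlgHom.comp_apply, aeval_X, Ideal.Quotient.mkₐ_eq_mk, Fin.reduceFinMk,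
        Matrix.cons_val]
      rw [eq_comm, Ideal.Quotient.eq, Ideal.mem_span_singleton]
      exact dvd_of_eq (by rw [lin]; ring)
  have h3 := DFunLike.congr_fun hq H
  rw [AlgHom.comp_apply, hρ0, map_zero, eq_comm, Ideal.Quotient.mkₐ_eq_mk,
    Ideal.Quotient.eq_zero_iff_mem, Ideal.mem_span_singleton] at h3
  exact h3

lemma exists_eq_lin_mul [Infinite K] {H : MvPolynomial (Fin 3) K} {n : ℕ}
    (hH : H.IsHomogeneous (n + 1)) {a b : K} (h : res a b H = 0) :
    ∃ G : MvPolynomial (Fin 3) K, G.IsHomogeneous n ∧ H = lin a b * G :=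
  exists_isHomogeneous_mul_of_mul (isHomogeneous_lin a b) (by rwa [add_comm])
    (lin_dvd_of_res_eq_zero hH h)

lemma exists_isHomogeneous_sum_eq {ι σ : Type*} [Fintype ι] {f : ι → MvPolynomial σ K} {d : ι → ℕ}
    (hf : ∀ i, (f i).IsHomogeneous (d i)) {n : ℕ} {g : MvPolynomial σ K} (hg : g.IsHomogeneous n)
    (hmem : g ∈ Ideal.span (Set.range f)) :
    ∃ A : ι → MvPolynomial σ K, (∀ i, (A i).IsHomogeneous (n - d i)) ∧ (∀ i, n < d i → A i = 0) ∧
      g = ∑ i, f i * A i := by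
  obtain ⟨c, hc⟩ := (Ideal.mem_span_range_iff_exists_fun).mp hmem
  classical
  refine ⟨fun i => if n < d i then 0 else homogeneousComponent (n - d i) (c i), fun i => ?_,
    fun i hi => if_pos hi, ?_⟩
  · dsimp only
    split_ifs
    · exact isHomogeneous_zero _ _ _
    · exact homogeneousComponent_isHomogeneous _ _
  · have h1 : homogeneousComponent n g = g := by rw [homogeneousComponent_of_mem hg, if_pos rfl]
    rw [← h1, ← hc, map_sum]
    refine Finset.sum_congr rfl fun i _ => ?_
    rw [mul_comm]
    dsimp only
    split_ifs with h
    · rw [homogeneousComponent_mul_of_lt (hf i) _ h, mul_zero]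
    · have := homogeneousComponent_mul_add (hf i) (c i) (n - d i)
      rwa [Nat.add_sub_cancel' (not_lt.mp h)] at this

end Homogeneous

section RelPrime

variable {K : Type*} [Field K]

lemma isUnit_of_dvd_X_sub_C {q : MvPolynomial (Fin 2) K} {a c : K} (h0 : q ∣ X 0 - C a)
    (h1 : q ∣ X 1 - C c) : IsUnit q := by
  by_contra hq
  obtain ⟨r, hr⟩ := h0
  obtain ⟨s, hs⟩ := h1
  have hxa : (X 0 - C a : MvPolynomial (Fin 2) K) ≠ 0 := by
    intro h
    have := congrArg (eval ![a + 1, 0]) h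
    simp at this
  have hzc : (X 1 - C c : MvPolynomial (Fin 2) K) ≠ 0 := by
    intro h
    have := congrArg (eval ![0, c + 1]) h
    simp at this
  have hq0 : q ≠ 0 := by rintro rfl; simp at hr; exact hxa hr
  have hr0 : r ≠ 0 := by rintro rfl; simp at hr; exact hxa hr
  have hs0 : s ≠ 0 := by rintro rfl; simp at hs; exact hzc hs
  have hqd : q.totalDegree ≠ 0 := by
    intro h
    rw [totalDegree_eq_zero_iff_eq_C] at h
    refine hq ?_
    rw [h]
    refine IsUnit.map C (isUnit_iff_ne_zero.mpr fun h' => hq0 ?_)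
    rw [h, h', map_zero]
  have hle : ∀ (i : Fin 2) (e : K), (X i - C e : MvPolynomial (Fin 2) K).totalDegree ≤ 1 :=
    fun i e => (totalDegree_sub_C_le _ _).trans (totalDegree_X i).le
  have hrd := hle 0 a
  have hsd := hle 1 c
  rw [hr, totalDegree_mul_of_isDomain hq0 hr0] at hrd
  rw [hs, totalDegree_mul_of_isDomain hq0 hs0] at hsd
  have hr1 : r.totalDegree = 0 := by omega
  have hs1 : s.totalDegree = 0 := by omega
  rw [totalDegree_eq_zero_iff_eq_C] at hr1 hs1
  have hcross : r * (X 1 - C c) = s * (X 0 - C a) := by rw [hr, hs]; ring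
  rw [hr1, hs1] at hcross
  have := congrArg (eval ![a, c + 1]) hcross
  simp at this
  rw [this, map_zero] at hr1
  exact hr0 hr1

lemma exists_eval_eq_zero_of_not_isUnit [IsAlgClosed K] {q : MvPolynomial (Fin 2) K}
    (hq : ¬ IsUnit q) : ∃ p : Fin 2 → K, eval p q = 0 := by
  obtain ⟨M, hM, hle⟩ := Ideal.exists_le_maximal (Ideal.span {q})
    (by rwa [Ne, Ideal.span_singleton_eq_top])
  obtain ⟨p, hp⟩ := MvPolynomial.isMaximal_iff_eq_vanishingIdeal_singleton (K := K) |>.mp hM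
  refine ⟨p, ?_⟩
  have h1 : q ∈ M := hle (Ideal.mem_span_singleton_self q)
  rw [hp] at h1
  simpa using h1

lemma isRelPrime_dehom [IsAlgClosed K] {f : Fin 3 → MvPolynomial (Fin 3) K} {d : Fin 3 → ℕ}
    (hf : ∀ i, (f i).IsHomogeneous (d i))
    (hI : (Ideal.span (Set.range f)).radical =
      RingHom.ker (constantCoeff : MvPolynomial (Fin 3) K →+* K)) :
    IsRelPrime (dehom K (f 0)) (dehom K (f 1)) := by
  have hne : dehom K (f 0) ≠ 0 := fun h =>
    ne_zero_of_radical_span_range_eq hI (dehom_eq_zero (hf 0) h)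
  refine WfDvdMonoid.isRelPrime_of_no_irreducible_factors (fun h => hne h.1) fun q hq h0 h1 => ?_
  have hqp : Prime q := hq.prime
  have hqI : (Ideal.span {q}).IsPrime := (Ideal.span_singleton_prime hq.ne_zero).mpr hqp
  obtain ⟨p, hp⟩ := exists_eval_eq_zero_of_not_isUnit hq.not_isUnit
  let mk : MvPolynomial (Fin 2) K →ₐ[K] MvPolynomial (Fin 2) K ⧸ Ideal.span {q} :=
    Ideal.Quotient.mkₐ K (Ideal.span {q})
  let Φ : MvPolynomial (Fin 3) K →ₐ[K] Polynomial (MvPolynomial (Fin 2) K ⧸ Ideal.span {q}) :=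
    aeval fun j => Polynomial.X * Polynomial.C (mk (![X 0, 1, X 1] j))
  let Ψ : MvPolynomial (Fin 3) K →ₐ[K] Polynomial K :=
    aeval fun j => Polynomial.X * Polynomial.C (![p 0, 1, p 1] j)
  let e : MvPolynomial (Fin 2) K ⧸ Ideal.span {q} →ₐ[K] K :=
    Ideal.Quotient.liftₐ (Ideal.span {q}) (aeval p) (by
      intro x hx
      obtain ⟨y, rfl⟩ := Ideal.mem_span_singleton.mp hx
      rw [map_mul, aeval_eq_eval, hp, zero_mul])
  have he : ∀ x, e (mk x) = eval p x := fun x => by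
    rw [← aeval_eq_eval]; rfl
  have hΨ : (Polynomial.mapAlgHom e).comp Φ = Ψ := by
    ext i : 1
    fin_cases i <;> simp [Φ, Ψ, he]
  have hC : ∀ (F : MvPolynomial (Fin 3) K) (n : ℕ), F.IsHomogeneous n →
      Φ F = Polynomial.X ^ n * Polynomial.C (mk (dehom K F)) := by
    intro F n hF
    rw [show Φ F = _ from aeval_mul_left_of_isHomogeneous hF _ _]
    congr 1
    have : (aeval fun j => Polynomial.C (mk (![X 0, 1, X 1] j)) :
        MvPolynomial (Fin 3) K →ₐ[K] Polynomial (MvPolynomial (Fin 2) K ⧸ Ideal.span {q})) =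
        (Polynomial.CAlgHom.comp mk).comp (dehom K) := by
      ext i : 1
      fin_cases i <;> simp [dehom]
    rw [this]; rfl
  have hmem : ∀ (F : MvPolynomial (Fin 3) K) (n : ℕ), F.IsHomogeneous n → q ∣ dehom K F →
      F ∈ RingHom.ker Φ := by
    intro F n hF hdvd
    rw [RingHom.mem_ker, hC F n hF]
    have : mk (dehom K F) = 0 :=
      Ideal.Quotient.eq_zero_iff_mem.mpr (Ideal.mem_span_singleton.mpr hdvd)
    rw [this, map_zero, mul_zero]
  have hmem' : ∀ (F : MvPolynomial (Fin 3) K) (n : ℕ), F.IsHomogeneous n → F ∈ RingHom.ker Φ →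
      q ∣ dehom K F := by
    intro F n hF hk
    rw [RingHom.mem_ker, hC F n hF, mul_eq_zero, Polynomial.C_eq_zero] at hk
    have := hk.resolve_left (pow_ne_zero _ Polynomial.X_ne_zero)
    exact Ideal.mem_span_singleton.mp (Ideal.Quotient.eq_zero_iff_mem.mp this)
  have hP : (RingHom.ker Φ).IsPrime := RingHom.ker_isPrime _
  have hQ : (RingHom.ker Ψ).IsPrime := RingHom.ker_isPrime _
  refine not_prime_chain_of_radical_eq hI (RingHom.ker Φ) (RingHom.ker Ψ)
    (hmem _ _ (hf 0) h0) (hmem _ _ (hf 1) h1) ?_ ?_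
  · refine lt_of_le_of_ne (fun x hx => ?_) fun heq => ?_
    · rw [RingHom.mem_ker] at hx ⊢
      rw [← hΨ, AlgHom.comp_apply, hx, map_zero]
    · have hlin : ∀ (c : K) (i : Fin 3), (X i - C c * X 1 : MvPolynomial (Fin 3) K).IsHomogeneous 1 :=
        fun c i => (isHomogeneous_X K i).sub
          (by simpa using (isHomogeneous_C (Fin 3) c).mul (isHomogeneous_X K 1))
      have k0 : (X 0 - C (p 0) * X 1 : MvPolynomial (Fin 3) K) ∈ RingHom.ker Ψ := by
        rw [RingHom.mem_ker]
        simp only [Ψ, map_sub, map_mul, aeval_X, algHom_C]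
        rw [← Polynomial.C_eq_algebraMap]
        simp
      have k1 : (X 2 - C (p 1) * X 1 : MvPolynomial (Fin 3) K) ∈ RingHom.ker Ψ := by
        rw [RingHom.mem_ker]
        simp only [Ψ, map_sub, map_mul, aeval_X, algHom_C]
        rw [← Polynomial.C_eq_algebraMap]
        simp
      rw [← heq] at k0 k1
      refine hq.not_isUnit (isUnit_of_dvd_X_sub_C (a := p 0) (c := p 1) ?_ ?_)
      · simpa [dehom, MvPolynomial.algebraMap_eq] using hmem' _ _ (hlin (p 0) 0) k0
      · simpa [dehom, MvPolynomial.algebraMap_eq] using hmem' _ _ (hlin (p 1) 2) k1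
  · refine SetLike.lt_iff_le_and_exists.mpr ⟨fun x hx => ?_, X 1, by simp [RingHom.mem_ker],
      by simp [RingHom.mem_ker, Ψ]⟩
    rw [RingHom.mem_ker] at hx ⊢
    have hcΨ : (Polynomial.constantCoeff).comp (Ψ : MvPolynomial (Fin 3) K →+* Polynomial K) =
        constantCoeff := by
      ext i
      · simp
      · simp [Ψ]
    rw [← hcΨ, RingHom.comp_apply, RingHom.coe_coe, hx, map_zero]

end RelPrime

section Theta

variable {K : Type*} [Field K]

/-- The isomorphism of `K[x, z][u]` with `K[u, v][x]` given by `v = z - u * x`. -/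
noncomputable def theta (K : Type*) [Field K] :
    Polynomial (MvPolynomial (Fin 2) K) ≃+* Polynomial (MvPolynomial (Fin 2) K) :=
  RingEquiv.ofRingHom
    (Polynomial.eval₂RingHom
      (aeval ![Polynomial.X, Polynomial.C (X 0) * Polynomial.X + Polynomial.C (X 1)] :
        MvPolynomial (Fin 2) K →ₐ[K] Polynomial (MvPolynomial (Fin 2) K)).toRingHom
      (Polynomial.C (X 0)))
    (Polynomial.eval₂RingHom
      (aeval ![Polynomial.X, Polynomial.C (X 1) - Polynomial.X * Polynomial.C (X 0)] :
        MvPolynomial (Fin 2) K →ₐ[K] Polynomial (MvPolynomial (Fin 2) K)).toRingHom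
      (Polynomial.C (X 0)))
    (by
      ext i : 2
      · ext; simp
      · fin_cases i <;> simp
      · simp)
    (by
      ext i : 2
      · ext; simp
      · fin_cases i <;> simp
      · simp)

lemma theta_C (G : MvPolynomial (Fin 2) K) :
    theta K (Polynomial.C G) =
      aeval ![Polynomial.X, Polynomial.C (X 0) * Polynomial.X + Polynomial.C (X 1)] G := by
  simp [theta]

lemma theta_symm_C (G : MvPolynomial (Fin 2) K) :
    (theta K).symm (Polynomial.C G) =
      aeval ![Polynomial.X, Polynomial.C (X 1) - Polynomial.X * Polynomial.C (X 0)] G := by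
  simp [theta]

lemma theta_symm_X : (theta K).symm Polynomial.X = Polynomial.C (X 0) := by
  simp [theta]

lemma theta_C_dehom (F : MvPolynomial (Fin 3) K) :
    theta K (Polynomial.C (dehom K F)) = gen K F := by
  rw [theta_C]
  have h : (aeval ![Polynomial.X, Polynomial.C (X 0) * Polynomial.X + Polynomial.C (X 1)] :
      MvPolynomial (Fin 2) K →ₐ[K] Polynomial (MvPolynomial (Fin 2) K)).comp (dehom K) = gen K := by
    ext i : 1
    fin_cases i <;> simp [dehom, gen]
  exact DFunLike.congr_fun h F

lemma natDegree_theta_derivative_symm_C_le (c : MvPolynomial (Fin 2) K) :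
    (theta K (Polynomial.derivative ((theta K).symm (Polynomial.C c)))).natDegree ≤ 1 := by
  induction c using MvPolynomial.induction_on with
  | C a => simp [theta_symm_C, algebraMap_eq,
      IsScalarTower.algebraMap_apply K (MvPolynomial (Fin 2) K) (Polynomial (MvPolynomial (Fin 2) K))]
  | add p q hp hq =>
    simp only [map_add]
    exact Polynomial.natDegree_add_le_of_degree_le hp hq
  | mul_X p i hp =>
    have hX : (theta K (Polynomial.derivative
        ((theta K).symm (Polynomial.C (X i))))).natDegree ≤ 1 := by
      fin_cases i
      · simp [theta_symm_C]
      · simp [theta_symm_C, theta_C]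
    rw [map_mul, map_mul, Polynomial.derivative_mul, map_add, map_mul, map_mul,
      RingEquiv.apply_symm_apply, RingEquiv.apply_symm_apply]
    refine Polynomial.natDegree_add_le_of_degree_le ?_ ?_
    · exact (Polynomial.natDegree_mul_C_le _ _).trans hp
    · exact (Polynomial.natDegree_C_mul_le _ _).trans hX

lemma natDegree_theta_derivative_le (g : Polynomial (MvPolynomial (Fin 2) K)) :
    (theta K (Polynomial.derivative g)).natDegree ≤ (theta K g).natDegree + 1 := by
  obtain ⟨p, rfl⟩ := (theta K).symm.surjective g
  rw [RingEquiv.apply_symm_apply]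
  conv_lhs => rw [p.as_sum_range_C_mul_X_pow]
  simp only [map_sum]
  refine Polynomial.natDegree_sum_le_of_forall_le _ _ fun j hj => ?_
  have hj' : j ≤ p.natDegree := Nat.lt_succ_iff.mp (Finset.mem_range.mp hj)
  rw [map_mul, map_pow, theta_symm_X, Polynomial.derivative_mul, ← Polynomial.C_pow,
    Polynomial.derivative_C, mul_zero, add_zero, map_mul, Polynomial.C_pow, map_pow, theta_C,
    aeval_X]
  refine Polynomial.natDegree_mul_le.trans ?_
  have := natDegree_theta_derivative_symm_C_le (p.coeff j)
  have h2 : ((![Polynomial.X, Polynomial.C (X 0) * Polynomial.X + Polynomial.C (X 1)] :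
    Fin 2 → Polynomial (MvPolynomial (Fin 2) K)) 0 ^ j).natDegree ≤ j := by simp
  omega

lemma totalDegree_le_natDegree_theta_C [Infinite K] (G : MvPolynomial (Fin 2) K) :
    G.totalDegree ≤ (theta K (Polynomial.C G)).natDegree := by
  rcases eq_or_ne G 0 with rfl | hG
  · simp
  set N := G.totalDegree with hN
  have hcoeff : (theta K (Polynomial.C G)).coeff N =
      aeval ![1, X 0] (homogeneousComponent N G) := by
    rw [theta_C, homogeneousComponent_apply]
    conv_lhs => rw [G.as_sum]
    rw [map_sum, map_sum, Polynomial.finsetSum_coeff, Finset.sum_filter]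
    refine Finset.sum_congr rfl fun m hm => ?_
    have hle : m.degree ≤ N := le_totalDegree hm
    have hdeg : m.degree = m 0 + m 1 := by
      rw [Finsupp.degree_eq_sum, Fin.sum_univ_two]
    have e1 : (aeval ![Polynomial.X, Polynomial.C (X 0) * Polynomial.X + Polynomial.C (X 1)]
        (monomial m (coeff m G)) : Polynomial (MvPolynomial (Fin 2) K)) =
        Polynomial.C (C (coeff m G)) * (Polynomial.X ^ m 0 *
          (Polynomial.C (X 0) * Polynomial.X + Polynomial.C (X 1)) ^ m 1) := by
      rw [aeval_monomial, Finsupp.prod_fintype _ _ (fun _ => pow_zero _), Fin.prod_univ_two]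
      rfl
    have e2 : (aeval ![1, X 0] (monomial m (coeff m G)) : MvPolynomial (Fin 2) K) =
        C (coeff m G) * X 0 ^ m 1 := by
      rw [aeval_monomial, Finsupp.prod_fintype _ _ (fun _ => pow_zero _), Fin.prod_univ_two]
      simp [algebraMap_eq]
    have hlin : (Polynomial.C (X 0) * Polynomial.X + Polynomial.C (X 1) :
        Polynomial (MvPolynomial (Fin 2) K)).natDegree ≤ 1 := Polynomial.natDegree_linear_le
    have hpow : ((Polynomial.C (X 0) * Polynomial.X + Polynomial.C (X 1) :
        Polynomial (MvPolynomial (Fin 2) K)) ^ m 1).natDegree ≤ m 1 :=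
      Polynomial.natDegree_pow_le.trans ((Nat.mul_le_mul_left _ hlin).trans (mul_one _).le)
    rw [e1, e2, Polynomial.coeff_C_mul]
    split_ifs with h
    · rw [← h, hdeg, add_comm (m 0), Polynomial.coeff_X_pow_mul]
      congr 1
      have := Polynomial.coeff_pow_of_natDegree_le (m := m 1) hlin
      rw [mul_one] at this
      rw [this]
      simp
    · rw [Polynomial.coeff_eq_zero_of_natDegree_lt, mul_zero]
      refine lt_of_le_of_lt Polynomial.natDegree_mul_le ?_
      rw [Polynomial.natDegree_X_pow]
      omega
  refine Polynomial.le_natDegree_of_ne_zero fun h0 => ?_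
  rw [hcoeff] at h0
  have hcomp : homogeneousComponent N G = 0 := by
    refine eq_zero_of_forall_eval_of_apply_eq_one (homogeneousComponent_isHomogeneous N G) 0
      fun p hp => ?_
    have h1 : (eval ![p 1, 0]).comp (aeval ![1, X 0] :
        MvPolynomial (Fin 2) K →ₐ[K] MvPolynomial (Fin 2) K).toRingHom = eval p := by
      ext i
      · simp
      · fin_cases i <;> simp [hp]
    rw [← h1, RingHom.comp_apply]
    erw [h0]
    rw [map_zero]
  obtain ⟨m, hm, hmN⟩ : ∃ m ∈ G.support, m.degree = N := by
    obtain ⟨m, hm, h⟩ := Finset.exists_mem_eq_sup G.support (support_nonempty.mpr hG)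
      (fun m => m.degree)
    exact ⟨m, hm, by rw [hN, totalDegree]; exact h.symm⟩
  have := congrArg (coeff m) hcomp
  rw [coeff_homogeneousComponent, if_pos hmN, coeff_zero] at this
  exact (mem_support_iff.mp hm) this

lemma isRelPrime_gen {F G : MvPolynomial (Fin 3) K} (hF : dehom K F ≠ 0)
    (h : IsRelPrime (dehom K F) (dehom K G)) : IsRelPrime (gen K F) (gen K G) := by
  rw [← theta_C_dehom, ← theta_C_dehom]
  intro q hq0 hq1
  obtain ⟨p, rfl⟩ := (theta K).surjective q
  rw [map_dvd_iff] at hq0 hq1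
  refine IsUnit.map _ ?_
  have hp0 : p.natDegree = 0 := by
    have := Polynomial.natDegree_le_of_dvd hq0 (by simpa using hF)
    simpa using this
  rw [Polynomial.eq_C_of_natDegree_eq_zero hp0] at hq0 hq1 ⊢
  refine IsUnit.map Polynomial.C (h ?_ ?_)
  · simpa using (Polynomial.C_dvd_iff_dvd_coeff _ _).mp hq0 0
  · simpa using (Polynomial.C_dvd_iff_dvd_coeff _ _).mp hq1 0

end Theta

section Regular

lemma exists_mul_add_mul_eq_C_of_isRelPrime {S : Type*} [CommRing S] [IsDomain S]
    [UniqueFactorizationMonoid S] {F G : Polynomial S} (hF : F ≠ 0) (h : IsRelPrime F G) :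
    ∃ A B : Polynomial S, ∃ δ : S, δ ≠ 0 ∧ A * F + B * G = Polynomial.C δ := by
  classical
  let φ := algebraMap S (FractionRing S)
  have hφ : Function.Injective φ := IsFractionRing.injective S (FractionRing S)
  obtain ⟨inst⟩ : Nonempty (NormalizedGCDMonoid S) := inferInstance
  have hcop : IsCoprime (F.map φ) (G.map φ) := by
    refine isCoprime_of_irreducible_dvd (fun h0 => hF ?_) fun z hz hzF hzG => ?_
    · exact (Polynomial.map_eq_zero_iff hφ).mp h0.1
    · set p := IsLocalization.integerNormalization (nonZeroDivisors S) z with hp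
      have hprim := p.isPrimitive_primPart
      have hdvd : ∀ E : Polynomial S, z ∣ E.map φ → p.primPart ∣ E := by
        intro E hE
        refine hprim.dvd_of_fraction_map_dvd_fraction_map (K := FractionRing S) (dvd_trans ?_ hE)
        obtain ⟨b, hb, hbz⟩ := IsLocalization.integerNormalization_spec (nonZeroDivisors S) z
        refine dvd_trans (Polynomial.map_dvd φ p.primPart_dvd) ?_
        rw [hp, hbz, ← IsScalarTower.algebraMap_smul (FractionRing S) b z]
        have hb0 : algebraMap S (FractionRing S) b ≠ 0 := fun h0 =>
          nonZeroDivisors.ne_zero hb (hφ (by rw [h0, map_zero]))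
        rw [Polynomial.smul_eq_C_mul]
        exact (IsUnit.mul_left_dvd
          (Polynomial.isUnit_C.mpr (isUnit_iff_ne_zero.mpr hb0))).mpr dvd_rfl
      exact hz.not_isUnit (Polynomial.isUnit_or_eq_zero_of_isUnit_integerNormalization_primPart
        hz.ne_zero (h (hdvd F hzF) (hdvd G hzG)))
  obtain ⟨A, B, hAB⟩ := hcop
  obtain ⟨α, hα, hA⟩ := IsLocalization.integerNormalization_spec (nonZeroDivisors S) A
  obtain ⟨β, hβ, hB⟩ := IsLocalization.integerNormalization_spec (nonZeroDivisors S) B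
  refine ⟨Polynomial.C β * IsLocalization.integerNormalization (nonZeroDivisors S) A,
    Polynomial.C α * IsLocalization.integerNormalization (nonZeroDivisors S) B, α * β,
    mul_ne_zero (nonZeroDivisors.ne_zero hα) (nonZeroDivisors.ne_zero hβ), ?_⟩
  apply Polynomial.map_injective φ hφ
  rw [← IsScalarTower.algebraMap_smul (FractionRing S), Polynomial.smul_eq_C_mul] at hA hB
  simp only [Polynomial.map_add, Polynomial.map_mul, Polynomial.map_C, map_mul]
  linear_combination (Polynomial.C (φ α) * Polynomial.C (φ β)) * hAB +
    (Polynomial.C (φ β) * F.map φ) * hA + (Polynomial.C (φ α) * G.map φ) * hB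

variable {K : Type*} [Field K]

lemma mem_span_pair_of_lin_mul_mem [Infinite K] {f₀ f₁ h : MvPolynomial (Fin 3) K} {d₀ d₁ m : ℕ}
    (hf₀ : f₀.IsHomogeneous d₀) (hf₁ : f₁.IsHomogeneous d₁) {a b : K}
    (hcop : IsCoprime (res a b f₀) (res a b f₁)) (hne : res a b f₀ ≠ 0)
    (hdeg : (res a b f₀).natDegree = d₀) (hh : h.IsHomogeneous m)
    (hmem : lin a b * h ∈ Ideal.span {f₀, f₁}) : h ∈ Ideal.span {f₀, f₁} := by
  have hrange : Set.range ![f₀, f₁] = {f₀, f₁} := by simp [Matrix.range_cons, Set.pair_comm]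
  rw [← hrange] at hmem
  have hlh : (lin a b * h).IsHomogeneous (m + 1) := by
    rw [add_comm]; exact (isHomogeneous_lin a b).mul hh
  obtain ⟨A, hA, hA0, hsum⟩ := exists_isHomogeneous_sum_eq (d := ![d₀, d₁])
    (by intro i; fin_cases i; exacts [hf₀, hf₁]) hlh hmem
  rw [Fin.sum_univ_two] at hsum
  simp only [Matrix.cons_val_zero, Matrix.cons_val_one] at hsum
  have hres : 0 = res a b f₀ * res a b (A 0) + res a b f₁ * res a b (A 1) := by
    have := congrArg (res a b) hsum
    simpa [res_lin] using this
  have hdvd : res a b f₀ ∣ res a b (A 1) :=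
    hcop.dvd_of_dvd_mul_left ⟨-res a b (A 0), by linear_combination -hres⟩
  obtain ⟨q, hq⟩ := hdvd
  have hq0 : res a b (A 0) = - (res a b f₁ * q) := by
    apply mul_left_cancel₀ hne
    rw [hq] at hres
    linear_combination -hres
  obtain ⟨c, hc, hc0, hc1⟩ : ∃ c : MvPolynomial (Fin 3) K, res a b c = q ∧
      (f₁ * c).IsHomogeneous (m + 1 - d₀) ∧ (f₀ * c).IsHomogeneous (m + 1 - d₁) := by
    rcases eq_or_ne q 0 with rfl | hq'
    · exact ⟨0, by simp, by simpa using isHomogeneous_zero _ _ _,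
        by simpa using isHomogeneous_zero _ _ _⟩
    · have h1 : (res a b (A 1)).natDegree = d₀ + q.natDegree := by
        rw [hq, Polynomial.natDegree_mul hne hq', hdeg]
      have h2 : (res a b (A 1)).natDegree ≤ m + 1 - d₁ := natDegree_res_le (hA 1) a b
      have h3 : d₁ ≤ m + 1 := by
        by_contra hlt
        rw [hA0 1 (not_le.mp hlt), map_zero] at hq
        exact mul_ne_zero hne hq' hq.symm
      obtain ⟨c, hc, hcq⟩ := exists_isHomogeneous_res_eq a b q (k := m + 1 - d₁ - d₀) (by omega)
      refine ⟨c, hcq, ?_, ?_⟩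
      · have := hf₁.mul hc
        rwa [show d₁ + (m + 1 - d₁ - d₀) = m + 1 - d₀ by omega] at this
      · have := hf₀.mul hc
        rwa [show d₀ + (m + 1 - d₁ - d₀) = m + 1 - d₁ by omega] at this
  obtain ⟨G₀, hG₀⟩ := lin_dvd_of_res_eq_zero ((hA 0).add hc0) (a := a) (b := b)
    (by rw [map_add, map_mul, hq0, hc]; ring)
  obtain ⟨G₁, hG₁⟩ := lin_dvd_of_res_eq_zero ((hA 1).sub hc1) (a := a) (b := b)
    (by rw [map_sub, map_mul, hq, hc]; ring)
  rw [Ideal.mem_span_pair]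
  refine ⟨G₀, G₁, ?_⟩
  apply mul_left_cancel₀ (lin_ne_zero a b)
  rw [hsum]
  linear_combination (-f₀) * hG₀ - f₁ * hG₁

lemma mem_span_pair_of_mul_mem [Infinite K] {f : Fin 3 → MvPolynomial (Fin 3) K} {d : Fin 3 → ℕ}
    (hf : ∀ i, (f i).IsHomogeneous (d i))
    (hI : (Ideal.span (Set.range f)).radical =
      RingHom.ker (constantCoeff : MvPolynomial (Fin 3) K →+* K)) {a b : K}
    (hcop : IsCoprime (res a b (f 0)) (res a b (f 1))) (hne : res a b (f 0) ≠ 0)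
    (hdeg : (res a b (f 0)).natDegree = d 0) {H : MvPolynomial (Fin 3) K} {n : ℕ}
    (hH : H.IsHomogeneous n) (hmem : H * f 2 ∈ Ideal.span {f 0, f 1}) :
    H ∈ Ideal.span {f 0, f 1} := by
  have hlin : lin a b ∈ (Ideal.span (Set.range f)).radical := by
    rw [hI, RingHom.mem_ker]; simp [lin]
  obtain ⟨k, hk⟩ := hlin
  have hpow : lin a b ^ k * H ∈ Ideal.span {f 0, f 1} := by
    obtain ⟨c, hc⟩ := Ideal.mem_span_range_iff_exists_fun.mp hk
    rw [← hc, Fin.sum_univ_three]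
    have h0 : f 0 ∈ Ideal.span {f 0, f 1} := Ideal.subset_span (by simp)
    have h1 : f 1 ∈ Ideal.span {f 0, f 1} := Ideal.subset_span (by simp)
    have e : (c 0 * f 0 + c 1 * f 1 + c 2 * f 2) * H =
      (c 0 * H) * f 0 + (c 1 * H) * f 1 + c 2 * (H * f 2) := by ring
    rw [e]
    exact add_mem (add_mem (Ideal.mul_mem_left _ _ h0) (Ideal.mul_mem_left _ _ h1))
      (Ideal.mul_mem_left _ _ hmem)
  clear hk
  induction k with
  | zero => simpa using hpow
  | succ k ih =>
    refine ih (mem_span_pair_of_lin_mul_mem (hf 0) (hf 1) hcop hne hdeg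
      (((isHomogeneous_lin a b).pow k).mul hH) ?_)
    convert hpow using 1
    ring

end Regular

section GenericSyzygy

lemma mul_cross_eq_mul_cross {S : Type*} [CommRing S] {a b c x y z x' y' z' : S}
    (h : x * a + y * b + z * c = 0) (h' : x' * a + y' * b + z' * c = 0) :
    a * (z * x' - x * z') = b * (y * z' - z * y') := by
  linear_combination z * h' - z' * h

variable {K : Type*} [Field K]

lemma dvd_of_forall_mul_eq_mul {S : Type*} [CommRing S] [IsDomain S] [NormalizedGCDMonoid S]
    {k k' : Fin 3 → S}
    (hk : Finset.univ.gcd k = 1) (h12 : k 1 * k' 2 = k 2 * k' 1) (h02 : k 0 * k' 2 = k 2 * k' 0)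
    (h01 : k 0 * k' 1 = k 1 * k' 0) (i : Fin 3) : k i ∣ k' i := by
  have h1 : k i ∣ Finset.univ.gcd fun j => k j * k' i := by
    refine Finset.dvd_gcd fun j _ => ⟨k' j, ?_⟩
    revert i j
    simp only [Fin.forall_fin_succ, Fin.isValue]
    simp [h12, h02, h01]
  have h2 := Finset.gcd_mul_right' Finset.univ k (k' i)
  rw [hk, one_mul] at h2
  exact h1.trans h2.dvd

lemma eq_zero_of_dehom_syzygy [Infinite K] {f : Fin 3 → MvPolynomial (Fin 3) K} {d : Fin 3 → ℕ}
    (hf : ∀ i, (f i).IsHomogeneous (d i)) (hne : dehom K (f 0) ≠ 0)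
    (hrel : IsRelPrime (dehom K (f 0)) (dehom K (f 1)))
    (hreg : ∀ (n : ℕ) (H : MvPolynomial (Fin 3) K), H.IsHomogeneous n →
      H * f 2 ∈ Ideal.span {f 0, f 1} → H ∈ Ideal.span {f 0, f 1})
    (hlead : (gen K (f 0)).natDegree = d 0) {e : ℕ}
    (h01 : e < d 0 + d 1) (h02 : e < d 0 + d 2) (h12 : e < d 1 + d 2)
    {G : Fin 3 → MvPolynomial (Fin 2) K}
    (hG : ∀ i, G i = 0 ∨ (theta K (Polynomial.C (G i))).natDegree + d i ≤ e)
    (hsum : ∑ i, G i * dehom K (f i) = 0) : ∀ i, G i = 0 := by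
  have hH : ∀ i, ∃ H : MvPolynomial (Fin 3) K, dehom K H = G i ∧ (f i * H).IsHomogeneous e ∧
      H.IsHomogeneous (e - d i) := by
    intro i
    rcases hG i with h0 | hle
    · exact ⟨0, by simp [h0], by simpa using isHomogeneous_zero _ _ _, isHomogeneous_zero _ _ _⟩
    · have htd := totalDegree_le_natDegree_theta_C (G i)
      obtain ⟨H, hH, hHG⟩ := exists_isHomogeneous_dehom_eq (G i) (k := e - d i) (by omega)
      refine ⟨H, hHG, ?_, hH⟩
      have := (hf i).mul hH
      rwa [Nat.add_sub_cancel' (by omega)] at this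
  choose H hHG hfH hHh using hH
  have hHsum : f 0 * H 0 + f 1 * H 1 + f 2 * H 2 = 0 := by
    refine dehom_eq_zero (((hfH 0).add (hfH 1)).add (hfH 2)) ?_
    rw [Fin.sum_univ_three] at hsum
    simp only [map_add, map_mul, hHG]
    linear_combination hsum
  have hmem : H 2 ∈ Ideal.span {f 0, f 1} := by
    refine hreg _ _ (hHh 2) ?_
    rw [Ideal.mem_span_pair]
    exact ⟨-H 0, -H 1, by linear_combination -hHsum⟩
  have hG2 : G 2 = 0 := by
    rcases hG 2 with h0 | hle
    · exact h0
    · have hrange : Set.range ![f 0, f 1] = {f 0, f 1} := by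
        simp [Matrix.range_cons, Set.pair_comm]
      rw [← hrange] at hmem
      obtain ⟨A, -, hA0, hAsum⟩ := exists_isHomogeneous_sum_eq (d := ![d 0, d 1])
        (by intro i; fin_cases i; exacts [hf 0, hf 1]) (hHh 2) hmem
      have hA0' := hA0 0 (show e - d 2 < d 0 by omega)
      have hA1' := hA0 1 (show e - d 2 < d 1 by omega)
      rw [Fin.sum_univ_two, hA0', hA1', mul_zero, mul_zero, add_zero] at hAsum
      rw [← hHG, hAsum, map_zero]
  rw [Fin.sum_univ_three, hG2, zero_mul, add_zero] at hsum
  have hG1 : G 1 = 0 := by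
    by_contra h1
    have hdvd : dehom K (f 0) ∣ G 1 :=
      hrel.dvd_of_dvd_mul_right ⟨-G 0, by linear_combination hsum⟩
    have hdvd' : gen K (f 0) ∣ theta K (Polynomial.C (G 1)) := by
      rw [← theta_C_dehom]
      exact map_dvd (theta K) (map_dvd Polynomial.C hdvd)
    have hle := Polynomial.natDegree_le_of_dvd hdvd' (by simpa using h1)
    have := (hG 1).resolve_left h1
    omega
  have hG0 : G 0 = 0 := by
    rw [hG1, zero_mul, add_zero] at hsum
    exact (mul_eq_zero.mp hsum).resolve_right hne
  intro i
  fin_cases i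
  exacts [hG0, hG1, hG2]

lemma eq_zero_of_gen_syzygy [CharZero K] {f : Fin 3 → MvPolynomial (Fin 3) K} {d : Fin 3 → ℕ}
    (hf : ∀ i, (f i).IsHomogeneous (d i)) (hne : dehom K (f 0) ≠ 0)
    (hrel : IsRelPrime (dehom K (f 0)) (dehom K (f 1)))
    (hreg : ∀ (n : ℕ) (H : MvPolynomial (Fin 3) K), H.IsHomogeneous n →
      H * f 2 ∈ Ideal.span {f 0, f 1} → H ∈ Ideal.span {f 0, f 1})
    (hlead : (gen K (f 0)).natDegree = d 0) {e : ℕ} (hd0 : 0 < d 0)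
    (he : 2 * e + 2 ≤ d 0 + d 1 + d 2)
    (h01 : e < d 0 + d 1) (h02 : e < d 0 + d 2) (h12 : e < d 1 + d 2)
    {g : Fin 3 → Polynomial (MvPolynomial (Fin 2) K)}
    (hg : ∀ i, g i = 0 ∨ (g i).natDegree + d i ≤ e)
    (hsum : ∑ i, g i * gen K (f i) = 0) : ∀ i, g i = 0 := by
  classical
  obtain ⟨inst⟩ : Nonempty (NormalizedGCDMonoid (Polynomial (MvPolynomial (Fin 2) K))) :=
    inferInstance
  by_contra hnot
  obtain ⟨k, hk, hgcd⟩ := Finset.extract_gcd (s := Finset.univ)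
    (fun i => (theta K).symm (g i)) Finset.univ_nonempty
  set γ := Finset.univ.gcd fun i => (theta K).symm (g i) with hγ
  have hγ0 : γ ≠ 0 := by
    intro h0
    rw [h0] at hk
    refine hnot fun i => ?_
    have := hk i (Finset.mem_univ i)
    rwa [zero_mul, EmbeddingLike.map_eq_zero_iff] at this
  have hgk : ∀ i, g i = theta K γ * theta K (k i) := by
    intro i
    rw [← map_mul, ← hk i (Finset.mem_univ i), RingEquiv.apply_symm_apply]
  have hkdeg : ∀ i, k i = 0 ∨ (theta K (k i)).natDegree + d i ≤ e := by
    intro i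
    by_cases h0 : k i = 0
    · exact Or.inl h0
    · right
      have hθγ : theta K γ ≠ 0 := by simpa using hγ0
      have hθk : theta K (k i) ≠ 0 := by simpa using h0
      have h1 := (hg i).resolve_left (by rw [hgk i]; exact mul_ne_zero hθγ hθk)
      rw [hgk i, Polynomial.natDegree_mul hθγ hθk] at h1
      omega
  have hksum : ∑ i, k i * Polynomial.C (dehom K (f i)) = 0 := by
    apply mul_left_cancel₀ hγ0
    apply (theta K).injective
    rw [mul_zero, map_zero, ← hsum, map_mul, map_sum, Finset.mul_sum]
    refine Finset.sum_congr rfl fun i _ => ?_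
    rw [map_mul, theta_C_dehom, hgk i, mul_assoc]
  have hkder : ∑ i, Polynomial.derivative (k i) * Polynomial.C (dehom K (f i)) = 0 := by
    have := congrArg Polynomial.derivative hksum
    simpa [Polynomial.derivative_mul] using this
  rw [Fin.sum_univ_three] at hksum hkder
  have hw : ∀ i j, Polynomial.derivative (k i) * k j = 0 ∨
      (theta K (Polynomial.derivative (k i) * k j)).natDegree + d i + d j ≤ 2 * e + 1 := by
    intro i j
    by_cases h0 : Polynomial.derivative (k i) * k j = 0
    · exact Or.inl h0
    · right
      have hj : k j ≠ 0 := right_ne_zero_of_mul h0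
      have hi' := left_ne_zero_of_mul h0
      have hi : k i ≠ 0 := by
        intro h; exact hi' (by rw [h, Polynomial.derivative_zero])
      have h1 := (hkdeg i).resolve_left hi
      have h2 := (hkdeg j).resolve_left hj
      have h3 := natDegree_theta_derivative_le (k i)
      rw [map_mul, Polynomial.natDegree_mul (by simpa using hi') (by simpa using hj)]
      omega
  have hφ0 : (Polynomial.C (dehom K (f 0)) : Polynomial (MvPolynomial (Fin 2) K)) ≠ 0 := by
    simpa using hne
  have hw0 : k 1 * Polynomial.derivative (k 2) = k 2 * Polynomial.derivative (k 1) := by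
    rw [← sub_eq_zero]
    by_contra h0
    have hdvd : gen K (f 0) ∣
        theta K (k 1 * Polynomial.derivative (k 2) - k 2 * Polynomial.derivative (k 1)) := by
      refine (isRelPrime_gen hne hrel).dvd_of_dvd_mul_right
        ⟨theta K (k 2 * Polynomial.derivative (k 0) - k 0 * Polynomial.derivative (k 2)), ?_⟩
      rw [← theta_C_dehom, ← theta_C_dehom, ← map_mul, ← map_mul]
      congr 1
      exact (mul_comm _ _).trans (mul_cross_eq_mul_cross hksum hkder).symm
    have hle := Polynomial.natDegree_le_of_dvd hdvd
      fun h => h0 ((map_eq_zero_iff _ (theta K).injective).mp h)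
    have hdeg : (theta K (k 1 * Polynomial.derivative (k 2) -
        k 2 * Polynomial.derivative (k 1))).natDegree ≤ d 0 - 1 := by
      rw [map_sub]
      refine Polynomial.natDegree_sub_le_of_le (n := d 0 - 1) (m := d 0 - 1) ?_ ?_ |>.trans (by simp)
      · rw [mul_comm]
        rcases hw 2 1 with h | h
        · simp [h]
        · omega
      · rw [mul_comm]
        rcases hw 1 2 with h | h
        · simp [h]
        · omega
    omega
  have hw1 : k 0 * Polynomial.derivative (k 2) = k 2 * Polynomial.derivative (k 0) := by
    have h1 := mul_cross_eq_mul_cross hksum hkder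
    rw [hw0, sub_self, mul_zero] at h1
    exact (sub_eq_zero.mp ((mul_eq_zero.mp h1).resolve_left hφ0)).symm
  have hw2 : k 0 * Polynomial.derivative (k 1) = k 1 * Polynomial.derivative (k 0) := by
    have h1 := mul_cross_eq_mul_cross ((add_right_comm _ _ _).trans hksum)
      ((add_right_comm _ _ _).trans hkder)
    rw [hw0, sub_self, mul_zero] at h1
    exact (sub_eq_zero.mp ((mul_eq_zero.mp h1).resolve_left hφ0)).symm
  have hdvd : ∀ i, k i ∣ Polynomial.derivative (k i) :=
    dvd_of_forall_mul_eq_mul hgcd hw0 hw1 hw2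
  have hconst : ∀ i, k i = Polynomial.C ((k i).coeff 0) := by
    intro i
    refine Polynomial.eq_C_of_natDegree_eq_zero
      (Polynomial.derivative_eq_zero.mp ?_)
    by_contra h0
    have h1 := Polynomial.natDegree_le_of_dvd (hdvd i) h0
    by_cases h2 : (k i).natDegree = 0
    · exact h0 (Polynomial.derivative_of_natDegree_zero h2)
    · exact absurd (Polynomial.natDegree_derivative_lt h2) (not_lt.mpr h1)
  have hzero := eq_zero_of_dehom_syzygy hf hne hrel hreg hlead h01 h02 h12
    (G := fun i => (k i).coeff 0)
    (fun i => (hkdeg i).imp (fun h => by rw [h, Polynomial.coeff_zero])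
      (fun h => by rwa [← hconst i]))
    (by
      rw [Fin.sum_univ_three]
      apply Polynomial.C_injective
      simp only [map_add, map_mul, map_zero, ← hconst]
      exact hksum)
  have : Finset.univ.gcd k = 0 := Finset.gcd_eq_zero_iff.mpr fun i _ => by
    rw [hconst i, hzero i, map_zero]
  rw [hgcd] at this
  exact one_ne_zero this

end GenericSyzygy

section Specialization

lemma Matrix.exists_mul_eq_smul_one_of_mulVec {S m n : Type*} [CommRing S] [IsDomain S] [Fintype m]
    [Fintype n] [DecidableEq m] [DecidableEq n] (M : Matrix m n S)
    (hM : ∀ v, M.mulVec v = 0 → v = 0) :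
    ∃ (N : Matrix n m S) (δ : S), δ ≠ 0 ∧ N * M = δ • (1 : Matrix n n S) := by
  let φ := algebraMap S (FractionRing S)
  have hφ : Function.Injective φ := IsFractionRing.injective S (FractionRing S)
  have hinj : LinearMap.ker (M.map φ).mulVecLin = ⊥ := by
    rw [LinearMap.ker_eq_bot']
    intro v hv
    obtain ⟨b, hb⟩ := IsLocalization.exist_integer_multiples_of_finite (nonZeroDivisors S) v
    choose w hw using hb
    have hb0 : φ b ≠ 0 := fun h0 => nonZeroDivisors.ne_zero b.2 (hφ (by rw [h0, map_zero]))
    have hw' : (fun i => φ (w i)) = φ b • v := by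
      funext i
      rw [hw i, Pi.smul_apply, smul_eq_mul, Algebra.smul_def]
    have hw0 : w = 0 := by
      apply hM
      funext i
      apply hφ
      have h1 := RingHom.map_mulVec φ M w i
      have h2 : (⇑φ ∘ w) = φ b • v := hw'
      rw [h1, h2, Matrix.mulVec_smul, ← Matrix.mulVecLin_apply, hv]
      simp
    have h3 : φ b • v = 0 := by
      rw [← hw', hw0]
      funext i
      simp
    exact (smul_eq_zero.mp h3).resolve_left hb0
  obtain ⟨g, hg⟩ := LinearMap.exists_leftInverse_of_injective _ hinj
  have hgM : LinearMap.toMatrix' g * M.map φ = 1 := by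
    have := congrArg LinearMap.toMatrix' hg
    rwa [LinearMap.toMatrix'_comp, ← Matrix.toLin'_apply', LinearMap.toMatrix'_toLin',
      LinearMap.toMatrix'_id] at this
  obtain ⟨b, hb⟩ := IsLocalization.exist_integer_multiples_of_finite (nonZeroDivisors S)
    (fun p : n × m => LinearMap.toMatrix' g p.1 p.2)
  choose w hw using hb
  refine ⟨Matrix.of fun i j => w (i, j), b, nonZeroDivisors.ne_zero b.2, ?_⟩
  have hinjm : Function.Injective (fun A : Matrix n n S => A.map φ) :=
    Matrix.map_injective hφ
  apply hinjm
  have h1 : (Matrix.of fun i j => w (i, j)).map φ = φ b • LinearMap.toMatrix' g := by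
    ext i j
    simp only [Matrix.map_apply, Matrix.of_apply, Matrix.smul_apply, smul_eq_mul]
    rw [hw (i, j)]
    exact Algebra.smul_def _ _
  change ((Matrix.of fun i j => w (i, j)) * M).map φ = _
  rw [Matrix.map_mul, h1, Matrix.smul_mul, hgM]
  ext i j
  simp [Matrix.one_apply, apply_ite φ]

lemma exists_forall_map_syzygy_eq_zero {ι S : Type*} [Fintype ι] [DecidableEq ι] [CommRing S]
    [IsDomain S] (F : ι → Polynomial S) (n : ι → ℕ)
    (hF : ∀ g : ι → Polynomial S, (∀ i, g i ∈ Polynomial.degreeLT S (n i)) →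
      ∑ i, g i * F i = 0 → ∀ i, g i = 0) :
    ∃ δ : S, δ ≠ 0 ∧ ∀ {L : Type*} [Field L] (φ : S →+* L), φ δ ≠ 0 →
      ∀ g : ι → Polynomial L, (∀ i, g i ∈ Polynomial.degreeLT L (n i)) →
        ∑ i, g i * (F i).map φ = 0 → ∀ i, g i = 0 := by
  let D := ∑ i, (n i + (F i).natDegree) + 1
  let M : Matrix (Fin D) (Σ i, Fin (n i)) S :=
    Matrix.of fun r j => (Polynomial.X ^ (j.2 : ℕ) * F j.1).coeff r
  obtain ⟨N, δ, hδ, hN⟩ := M.exists_mul_eq_smul_one_of_mulVec fun v hv => by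
    let g : ι → Polynomial S := fun i =>
      ∑ k : Fin (n i), Polynomial.C (v ⟨i, k⟩) * Polynomial.X ^ (k : ℕ)
    have hg : ∀ i, g i ∈ Polynomial.degreeLT S (n i) := fun i =>
      Submodule.sum_mem _ fun k _ => Polynomial.mem_degreeLT.mpr
        ((Polynomial.degree_C_mul_X_pow_le _ _).trans_lt (by exact_mod_cast k.2))
    have hcoeff : ∀ r : ℕ, (∑ i, g i * F i).coeff r =
        ∑ j : (Σ i, Fin (n i)), (Polynomial.X ^ (j.2 : ℕ) * F j.1).coeff r * v j := by
      intro r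
      rw [Polynomial.finsetSum_coeff, Fintype.sum_sigma]
      refine Finset.sum_congr rfl fun i _ => ?_
      rw [Finset.sum_mul, Polynomial.finsetSum_coeff]
      refine Finset.sum_congr rfl fun k _ => ?_
      rw [mul_assoc, Polynomial.coeff_C_mul, mul_comm]
    have hsum : ∑ i, g i * F i = 0 := by
      ext r
      rw [Polynomial.coeff_zero]
      by_cases hr : r < D
      · rw [hcoeff]
        exact congrFun hv ⟨r, hr⟩
      · refine Polynomial.coeff_eq_zero_of_natDegree_lt (lt_of_le_of_lt ?_ (not_lt.mp hr))
        refine Polynomial.natDegree_sum_le_of_forall_le _ _ fun i _ => ?_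
        refine Polynomial.natDegree_mul_le.trans ?_
        refine le_trans (Nat.add_le_add_right ?_ _)
          (Finset.single_le_sum (f := fun i => n i + (F i).natDegree) (fun _ _ => Nat.zero_le _)
            (Finset.mem_univ i))
        refine Polynomial.natDegree_sum_le_of_forall_le _ _ fun k _ => ?_
        exact (Polynomial.natDegree_C_mul_X_pow_le _ _).trans k.2.le
    have hzero := hF g hg hsum
    funext ⟨i, k⟩
    have := congrArg (fun p => p.coeff (k : ℕ)) (hzero i)
    simpa [g, Polynomial.finsetSum_coeff, Polynomial.coeff_X_pow, Fin.val_inj] using this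
  refine ⟨δ, hδ, fun {L} _ φ hφ g hg hsum => ?_⟩
  let v : (Σ i, Fin (n i)) → L := fun j => (g j.1).coeff j.2
  have hgv : ∀ i, g i = ∑ k : Fin (n i), Polynomial.C (v ⟨i, k⟩) * Polynomial.X ^ (k : ℕ) := by
    intro i
    rw [Fin.sum_univ_eq_sum_range (fun k => Polynomial.C ((g i).coeff k) * Polynomial.X ^ k)]
    ext r
    simp only [Polynomial.finsetSum_coeff, Polynomial.coeff_C_mul, Polynomial.coeff_X_pow,
      mul_ite, mul_one, mul_zero, Finset.sum_ite_eq, Finset.mem_range]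
    split_ifs with h
    · rfl
    · exact Polynomial.coeff_eq_zero_of_degree_lt
        ((Polynomial.mem_degreeLT.mp (hg i)).trans_le (by exact_mod_cast not_lt.mp h))
  have hMv : (M.map φ).mulVec v = 0 := by
    funext r
    have h1 : (∑ i, g i * (F i).map φ).coeff r =
        ∑ j : (Σ i, Fin (n i)), φ ((Polynomial.X ^ (j.2 : ℕ) * F j.1).coeff r) * v j := by
      rw [Polynomial.finsetSum_coeff, Fintype.sum_sigma]
      refine Finset.sum_congr rfl fun i _ => ?_
      rw [hgv i, Finset.sum_mul, Polynomial.finsetSum_coeff]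
      refine Finset.sum_congr rfl fun k _ => ?_
      rw [mul_assoc, Polynomial.coeff_C_mul, mul_comm, ← Polynomial.coeff_map, Polynomial.map_mul,
        Polynomial.map_pow, Polynomial.map_X]
    rw [hsum] at h1
    exact h1.symm
  have hv : φ δ • v = 0 := by
    have h1 : N.map φ * M.map φ = φ δ • 1 := by
      rw [← Matrix.map_mul, hN]
      ext i j
      simp [Matrix.one_apply, apply_ite φ]
    have h2 := congrArg (fun A : Matrix _ _ L => A.mulVec v) h1
    simpa [← Matrix.mulVec_mulVec, hMv, Matrix.smul_mulVec] using h2.symm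
  have hv0 := (smul_eq_zero.mp hv).resolve_left hφ
  intro i
  rw [hgv i, hv0]
  simp

end Specialization

section Syzygy

variable {K : Type*} [Field K]

/-- The polynomials `p i`, of formal degrees `d i`, have no nonzero syzygy of degree at most `n`. -/
def SyzygyFree (p : Fin 3 → Polynomial K) (d : Fin 3 → ℕ) (n : ℕ) : Prop :=
  ∀ q : Fin 3 → Polynomial K, (∀ i, q i ∈ Polynomial.degreeLT K (n + 1 - d i)) →
    ∑ i, q i * p i = 0 → ∀ i, q i = 0

/-- Every polynomial of degree at most `n` is a combination of the `p i`, of formal degrees `d i`,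
whose terms have degree at most `n`. -/
def SpansDegree (p : Fin 3 → Polynomial K) (d : Fin 3 → ℕ) (n : ℕ) : Prop :=
  ∀ g : Polynomial K, g.natDegree ≤ n →
    ∃ q : Fin 3 → Polynomial K, (∀ i, q i ∈ Polynomial.degreeLT K (n + 1 - d i)) ∧
      ∑ i, q i * p i = g

variable {p : Fin 3 → Polynomial K} {d : Fin 3 → ℕ}

lemma mem_degreeLT_iff_natDegree {q : Polynomial K} {n : ℕ} :
    q ∈ Polynomial.degreeLT K n ↔ q = 0 ∨ q.natDegree < n := by
  rw [Polynomial.mem_degreeLT]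
  rcases eq_or_ne q 0 with rfl | hq
  · simp
  · rw [← Polynomial.natDegree_lt_iff_degree_lt hq]
    simp [hq]

lemma SyzygyFree.mono {m n : ℕ} (h : SyzygyFree p d n) (hmn : m ≤ n) : SyzygyFree p d m :=
  fun q hq => h q fun i => Polynomial.degreeLT_mono (by omega) (hq i)

lemma X_mul_mem_degreeLT {q : Polynomial K} {n k : ℕ}
    (hq : q ∈ Polynomial.degreeLT K (n + 1 - k)) :
    Polynomial.X * q ∈ Polynomial.degreeLT K (n + 1 + 1 - k) := by
  rw [mem_degreeLT_iff_natDegree] at hq ⊢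
  rcases hq with rfl | hq
  · simp
  · right
    have := Polynomial.natDegree_mul_le (p := Polynomial.X) (q := q)
    rw [Polynomial.natDegree_X] at this
    omega

lemma SpansDegree.succ {n : ℕ} (h : SpansDegree p d n) : SpansDegree p d (n + 1) := by
  intro g hg
  obtain ⟨q, hq, hqg⟩ := h g.divX (by rw [Polynomial.natDegree_divX_eq_natDegree_tsub_one]; omega)
  obtain ⟨r, hr, hrg⟩ := h (Polynomial.C (g.coeff 0)) (by simp)
  refine ⟨fun i => Polynomial.X * q i + r i, fun i => Submodule.add_mem _
    (X_mul_mem_degreeLT (hq i)) (Polynomial.degreeLT_mono (by omega) (hr i)), ?_⟩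
  conv_rhs => rw [← g.divX_mul_X_add, ← hqg, ← hrg]
  rw [Finset.sum_mul, ← Finset.sum_add_distrib]
  exact Finset.sum_congr rfl fun i _ => by ring

lemma SpansDegree.mono {m n : ℕ} (h : SpansDegree p d m) (hmn : m ≤ n) : SpansDegree p d n := by
  induction n, hmn using Nat.le_induction with
  | base => exact h
  | succ n _ ih => exact ih.succ

lemma syzygyFree_of_isCoprime (hcop : IsCoprime (p 0) (p 1)) (hdeg : (p 0).natDegree = d 0)
    (hne : p 0 ≠ 0) {n : ℕ} (h2 : n < d 2) (h01 : n < d 0 + d 1) : SyzygyFree p d n := by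
  intro q hq hsum
  have hq2 : q 2 = 0 := by
    have := hq 2
    rw [mem_degreeLT_iff_natDegree] at this
    exact this.resolve_right (by omega)
  rw [Fin.sum_univ_three, hq2, zero_mul, add_zero] at hsum
  have hq1 : q 1 = 0 := by
    have hdvd : p 0 ∣ q 1 := hcop.dvd_of_dvd_mul_right ⟨-q 0, by linear_combination hsum⟩
    by_contra h0
    have h1 := Polynomial.natDegree_le_of_dvd hdvd h0
    have := (mem_degreeLT_iff_natDegree.mp (hq 1)).resolve_left h0
    omega
  rw [hq1, zero_mul, add_zero] at hsum
  have hq0 := (mul_eq_zero.mp hsum).resolve_right hne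
  intro i
  fin_cases i
  exacts [hq0, hq1, hq2]

lemma spansDegree_of_isCoprime (hcop : IsCoprime (p 0) (p 1)) (hdeg : (p 0).natDegree = d 0)
    (hdeg1 : (p 1).natDegree ≤ d 1) (hd0 : 0 < d 0) {n : ℕ} (hn : d 0 + d 1 = n + 1) :
    SpansDegree p d n := by
  intro g hg
  have hne : p 0 ≠ 0 := by
    intro h
    rw [h, Polynomial.natDegree_zero] at hdeg
    omega
  obtain ⟨u, v, huv⟩ := hcop
  have hmod := EuclideanDomain.div_add_mod (g * v) (p 0)
  have hlt : ((g * v) % p 0).natDegree < d 0 := by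
    rw [← hdeg]; exact Polynomial.natDegree_mod_lt _ (by omega)
  set B := (g * v) % p 0
  have hA : (g * u + (g * v / p 0) * p 1) * p 0 = g - B * p 1 := by
    linear_combination g * huv + p 1 * hmod
  set A := g * u + (g * v / p 0) * p 1
  refine ⟨![A, B, 0], ?_, ?_⟩
  · have hBmem : B ∈ Polynomial.degreeLT K (n + 1 - d 1) :=
      mem_degreeLT_iff_natDegree.mpr (Or.inr (by omega))
    have hAmem : A ∈ Polynomial.degreeLT K (n + 1 - d 0) := by
      rw [mem_degreeLT_iff_natDegree]
      refine or_iff_not_imp_left.mpr fun hA0 => ?_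
      have h1 := Polynomial.natDegree_mul hA0 hne
      rw [hA, hdeg] at h1
      have h2 : (g - B * p 1).natDegree ≤ n := by
        refine (Polynomial.natDegree_sub_le_of_le hg
          (Polynomial.natDegree_mul_le.trans (Nat.add_le_add_left hdeg1 _))).trans ?_
        exact max_le le_rfl (by omega)
      omega
    intro i
    fin_cases i
    exacts [hAmem, hBmem, Submodule.zero_mem _]
  · rw [Fin.sum_univ_three]
    simp only [Matrix.cons_val]
    linear_combination hA

/-- The linear map sending `q` to `∑ i, q i * p i`. -/
noncomputable def combination (p : Fin 3 → Polynomial K) (k : Fin 3 → ℕ) :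
    (Π i, Polynomial.degreeLT K (k i)) →ₗ[K] Polynomial K :=
  ∑ i, LinearMap.mulRight K (p i) ∘ₗ (Polynomial.degreeLT K (k i)).subtype ∘ₗ LinearMap.proj i

lemma combination_apply (p : Fin 3 → Polynomial K) (k : Fin 3 → ℕ)
    (q : Π i, Polynomial.degreeLT K (k i)) : combination p k q = ∑ i, (q i : Polynomial K) * p i := by
  simp [combination]

lemma finrank_degreeLT (n : ℕ) : Module.finrank K (Polynomial.degreeLT K n) = n := by
  rw [(Polynomial.degreeLTEquiv K n).finrank_eq, Module.finrank_fin_fun]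

instance (n : ℕ) : Module.Finite K (Polynomial.degreeLT K n) :=
  Module.Finite.equiv (Polynomial.degreeLTEquiv K n).symm

lemma spansDegree_of_finrank_ker (hp : ∀ i, (p i).natDegree ≤ d i) {n : ℕ}
    (h : Module.finrank K (LinearMap.ker (combination p fun i => n + 1 - d i)) + (n + 1) ≤
      ∑ i, (n + 1 - d i)) : SpansDegree p d n := by
  have hle : LinearMap.range (combination p fun i => n + 1 - d i) ≤
      Polynomial.degreeLT K (n + 1) := by
    rintro _ ⟨q, rfl⟩
    rw [combination_apply]
    refine Submodule.sum_mem _ fun i _ => ?_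
    have hq := mem_degreeLT_iff_natDegree.mp (q i).2
    rw [mem_degreeLT_iff_natDegree]
    rcases hq with hq | hq
    · left; rw [hq, zero_mul]
    · right
      have h1 := Polynomial.natDegree_mul_le (p := (q i : Polynomial K)) (q := p i)
      have h2 := hp i
      omega
  have heq := Submodule.eq_of_le_of_finrank_le hle (by
    have h1 := LinearMap.finrank_range_add_finrank_ker (combination p fun i => n + 1 - d i)
    rw [Module.finrank_pi_fintype] at h1
    simp only [finrank_degreeLT] at h1 ⊢
    omega)
  intro g hg
  have hmem : g ∈ Polynomial.degreeLT K (n + 1) :=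
    mem_degreeLT_iff_natDegree.mpr (Or.inr (by omega))
  rw [← heq] at hmem
  obtain ⟨q, hq⟩ := hmem
  exact ⟨fun i => q i, fun i => (q i).2, by rw [← hq, combination_apply]⟩

lemma SyzygyFree.spansDegree (hp : ∀ i, (p i).natDegree ≤ d i) {n : ℕ} (h : SyzygyFree p d n)
    (hn : n + 1 ≤ ∑ i, (n + 1 - d i)) : SpansDegree p d n := by
  refine spansDegree_of_finrank_ker hp ?_
  have hker : LinearMap.ker (combination p fun i => n + 1 - d i) = ⊥ := by
    rw [LinearMap.ker_eq_bot']
    intro q hq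
    rw [combination_apply] at hq
    funext i
    exact Subtype.ext (h (fun i => q i) (fun i => (q i).2) hq i)
  rw [hker, finrank_bot, zero_add]
  exact hn

lemma SyzygyFree.eq_zero_of_coeff_zero {n : ℕ} (h : SyzygyFree p d n) {q : Fin 3 → Polynomial K}
    (hq : ∀ i, q i ∈ Polynomial.degreeLT K (n + 1 + 1 - d i)) (hsum : ∑ i, q i * p i = 0)
    (h0 : ∀ i, (q i).coeff 0 = 0) : ∀ i, q i = 0 := by
  have hX : ∀ i, q i = (q i).divX * Polynomial.X := by
    intro i
    conv_lhs => rw [← (q i).divX_mul_X_add, h0 i, map_zero, add_zero]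
  have := h (fun i => (q i).divX) (fun i => by
    have := hq i
    rw [mem_degreeLT_iff_natDegree] at this ⊢
    rcases this with h1 | h1
    · left; rw [h1, Polynomial.divX_zero]
    · refine or_iff_not_imp_left.mpr fun h2 => ?_
      have h3 := Polynomial.natDegree_mul_X h2
      rw [← hX i] at h3
      omega) (by
    apply mul_right_cancel₀ (Polynomial.X_ne_zero (R := K))
    rw [zero_mul, ← hsum, Finset.sum_mul]
    refine Finset.sum_congr rfl fun i _ => ?_
    conv_rhs => rw [hX i]
    ring)
  intro i
  rw [hX i, this i, zero_mul]

lemma SyzygyFree.spansDegree_succ (hp : ∀ i, (p i).natDegree ≤ d i)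
    (hcop : IsCoprime (p 0) (p 1)) (hdeg : (p 0).natDegree = d 0) (hd0 : 0 < d 0) {n : ℕ}
    (h : SyzygyFree p d n) (hn : 2 * n + 3 = d 0 + d 1 + d 2) (hn1 : d 1 ≤ n + 1)
    (hn2 : d 2 ≤ n + 1) (hsum : n + 3 ≤ ∑ i, (n + 1 + 1 - d i)) : SpansDegree p d (n + 1) := by
  refine spansDegree_of_finrank_ker hp ?_
  suffices hker : Module.finrank K
      (LinearMap.ker (combination p fun i => n + 1 + 1 - d i)) ≤ 1 by omega
  have hne : p 0 ≠ 0 := by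
    intro h
    rw [h, Polynomial.natDegree_zero] at hdeg
    omega
  have hmem : ∀ q : LinearMap.ker (combination p fun i => n + 1 + 1 - d i),
      ∑ i, (q.1 i : Polynomial K) * p i = 0 := by
    rintro ⟨q, hq⟩
    rwa [LinearMap.mem_ker, combination_apply] at hq
  have hcross : ∀ q q' : LinearMap.ker (combination p fun i => n + 1 + 1 - d i), ∀ i j,
      (q.1 i : Polynomial K) * q'.1 j = q.1 j * q'.1 i := by
    intro q q'
    have hq := hmem q
    have hq' := hmem q'
    rw [Fin.sum_univ_three] at hq hq'
    have hwdeg : ∀ r r' : LinearMap.ker (combination p fun i => n + 1 + 1 - d i),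
        ((r.1 1 : Polynomial K) * r'.1 2).natDegree < d 0 := by
      intro r r'
      have h1 := mem_degreeLT_iff_natDegree.mp (r.1 1).2
      have h2 := mem_degreeLT_iff_natDegree.mp (r'.1 2).2
      rcases h1 with h1 | h1
      · simpa [h1] using hd0
      rcases h2 with h2 | h2
      · simpa [h2] using hd0
      have := Polynomial.natDegree_mul_le (p := (r.1 1 : Polynomial K)) (q := r'.1 2)
      omega
    have h0 : (q.1 1 : Polynomial K) * q'.1 2 - q.1 2 * q'.1 1 = 0 := by
      by_contra h0
      have hdvd : p 0 ∣ (q.1 1 : Polynomial K) * q'.1 2 - q.1 2 * q'.1 1 :=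
        hcop.dvd_of_dvd_mul_left ⟨_, (mul_cross_eq_mul_cross hq hq').symm⟩
      have h1 := Polynomial.natDegree_le_of_dvd hdvd h0
      have h2 := Polynomial.natDegree_sub_le_of_le (Nat.le_sub_one_of_lt (hwdeg q q'))
        (Nat.le_sub_one_of_lt (hwdeg q' q))
      rw [mul_comm (q'.1 1 : Polynomial K), max_self] at h2
      omega
    have h1 := mul_cross_eq_mul_cross hq hq'
    rw [h0, mul_zero] at h1
    have h2 := mul_cross_eq_mul_cross ((add_right_comm _ _ _).trans hq)
      ((add_right_comm _ _ _).trans hq')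
    rw [show (q.1 2 : Polynomial K) * q'.1 1 - q.1 1 * q'.1 2 = 0 by linear_combination -h0,
      mul_zero] at h2
    have h1' := (mul_eq_zero.mp h1).resolve_left hne
    have h2' := (mul_eq_zero.mp h2).resolve_left hne
    intro i j
    fin_cases i <;> fin_cases j <;> simp only [Fin.zero_eta, Fin.mk_one, Fin.reduceFinMk]
    · linear_combination -h2'
    · linear_combination -h1'
    · linear_combination h2'
    · linear_combination h0
    · linear_combination h1'
    · linear_combination -h0
  by_cases hex : ∃ (q : LinearMap.ker (combination p fun i => n + 1 + 1 - d i)) (i : Fin 3),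
      (q.1 i : Polynomial K).coeff 0 ≠ 0
  · obtain ⟨q, i, hqi⟩ := hex
    refine finrank_le_one q fun q' => ?_
    refine ⟨(q'.1 i : Polynomial K).coeff 0 * ((q.1 i : Polynomial K).coeff 0)⁻¹, ?_⟩
    rw [← sub_eq_zero]
    set r := ((q'.1 i : Polynomial K).coeff 0 * ((q.1 i : Polynomial K).coeff 0)⁻¹) • q - q'
      with hr
    refine Subtype.ext (funext fun j => Subtype.ext ?_)
    refine h.eq_zero_of_coeff_zero (fun j => (r.1 j).2) (hmem r) (fun j => ?_) j
    have hc := congrArg (fun s => Polynomial.coeff s 0) (hcross q q' i j)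
    simp only [Polynomial.mul_coeff_zero] at hc
    simp only [hr, Submodule.coe_sub, Submodule.coe_smul, Pi.sub_apply, Pi.smul_apply,
      Polynomial.coeff_sub, Polynomial.coeff_smul, smul_eq_mul]
    field_simp
    linear_combination -hc
  · push Not at hex
    have hbot : LinearMap.ker (combination p fun i => n + 1 + 1 - d i) = ⊥ := by
      rw [eq_bot_iff]
      intro q hq
      refine funext fun j => Subtype.ext ?_
      exact h.eq_zero_of_coeff_zero (fun j => (q j).2) (hmem ⟨q, hq⟩) (hex ⟨q, hq⟩) j
    rw [hbot, finrank_bot]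
    exact zero_le_one

end Syzygy

section Lefschetz

variable {K : Type*} [Field K] {f : Fin 3 → MvPolynomial (Fin 3) K} {d : Fin 3 → ℕ}

lemma lefInj_of_syzygyFree [Infinite K] (hf : ∀ i, (f i).IsHomogeneous (d i)) {a b : K} {m : ℕ}
    (h : SyzygyFree (fun i => res a b (f i)) d (m + 1)) :
    LefInj (Ideal.span (Set.range f)) (lin a b) m := by
  intro g hg hmem
  have hlg : (lin a b * g).IsHomogeneous (m + 1) := by
    rw [add_comm]; exact (isHomogeneous_lin a b).mul hg
  obtain ⟨A, hA, hA0, hsum⟩ := exists_isHomogeneous_sum_eq hf hlg hmem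
  have hres := h (fun i => res a b (A i)) (fun i => by
    rw [mem_degreeLT_iff_natDegree]
    by_cases hi : m + 1 < d i
    · left; rw [hA0 i hi, map_zero]
    · right
      have := natDegree_res_le (hA i) a b
      omega) (by
    have h1 := congrArg (res a b) hsum
    rw [map_mul, res_lin, zero_mul, map_sum] at h1
    rw [h1]
    exact Finset.sum_congr rfl fun i _ => by rw [map_mul, mul_comm])
  choose c hc using fun i => lin_dvd_of_res_eq_zero (hA i) (hres i)
  have hg' : g = ∑ i, c i * f i := by
    apply mul_left_cancel₀ (lin_ne_zero a b)
    rw [hsum, Finset.mul_sum]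
    exact Finset.sum_congr rfl fun i _ => by rw [hc i]; ring
  rw [hg']
  exact Ideal.mem_span_range_iff_exists_fun.mpr ⟨c, rfl⟩

lemma lefSurj_of_spansDegree [Infinite K] (hf : ∀ i, (f i).IsHomogeneous (d i)) {a b : K} {m : ℕ}
    (h : SpansDegree (fun i => res a b (f i)) d (m + 1)) :
    LefSurj (Ideal.span (Set.range f)) (lin a b) m := by
  intro g hg
  obtain ⟨q, hq, hsum⟩ := h (res a b g) (natDegree_res_le hg a b)
  have hlift : ∀ i, ∃ H : MvPolynomial (Fin 3) K, (H * f i).IsHomogeneous (m + 1) ∧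
      res a b H = q i := by
    intro i
    rcases mem_degreeLT_iff_natDegree.mp (hq i) with h0 | hlt
    · exact ⟨0, by simpa using isHomogeneous_zero _ _ _, by rw [h0, map_zero]⟩
    · obtain ⟨H, hH, hHq⟩ := exists_isHomogeneous_res_eq a b (q i) (k := m + 1 - d i) (by omega)
      refine ⟨H, ?_, hHq⟩
      have := hH.mul (hf i)
      rwa [Nat.sub_add_cancel (by omega)] at this
  choose H hH hHq using hlift
  obtain ⟨c, hc, hgc⟩ := exists_eq_lin_mul (a := a) (b := b)
    (hg.sub (IsHomogeneous.sum Finset.univ (fun i => H i * f i) (m + 1) fun i _ => hH i)) (by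
      rw [map_sub, map_sum, sub_eq_zero, ← hsum]
      exact Finset.sum_congr rfl fun i _ => by rw [map_mul, hHq])
  refine ⟨c, hc, ?_⟩
  rw [← hgc, sub_sub_cancel]
  exact Ideal.mem_span_range_iff_exists_fun.mpr ⟨H, rfl⟩

lemma coeff_res_zero_zero {F : MvPolynomial (Fin 3) K} {n : ℕ} (hF : F.IsHomogeneous n) :
    (res 0 0 F).coeff n = eval ![1, 0, 0] F := by
  rw [res, aeval_def, eval₂_eq', eval_eq', Polynomial.finsetSum_coeff]
  refine Finset.sum_congr rfl fun s hs => ?_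
  have hdeg : ∑ i, s i = n := by
    rw [hF.degree_eq_sum_deg_support hs]
    exact (Finsupp.sum_fintype s (fun _ k => k) fun _ => rfl).symm
  rw [Fin.sum_univ_three] at hdeg
  rw [Polynomial.algebraMap_eq, Polynomial.coeff_C_mul, Fin.prod_univ_three, Fin.prod_univ_three]
  congr 1
  by_cases h2 : s 2 = 0
  · by_cases h1 : s 1 = 0
    · have h0 : s 0 = n := by omega
      simp [h2, h1, h0]
    · have h0 : n ≠ s 0 := by omega
      simp [h2, h1, h0, Polynomial.coeff_X_pow]
  · simp [h2]

lemma exists_eval_ne_zero [Infinite K] {c : MvPolynomial (Fin 2) K} (hc : c ≠ 0) :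
    ∃ a b : K, eval ![a, b] c ≠ 0 := by
  by_contra! h
  refine hc (MvPolynomial.funext fun x => ?_)
  have := h (x 0) (x 1)
  rw [map_zero, ← this]
  congr 1
  congr 1
  funext i
  fin_cases i <;> rfl

lemma weakLefschetz_of_eval_ne_zero [IsAlgClosed K] [CharZero K] (hd : ∀ i, 0 < d i)
    (hf : ∀ i, (f i).IsHomogeneous (d i))
    (hI : (Ideal.span (Set.range f)).radical =
      RingHom.ker (constantCoeff : MvPolynomial (Fin 3) K →+* K))
    (h02 : d 0 ≤ d 2) (h12 : d 1 ≤ d 2) (heval : eval ![1, 0, 0] (f 0) ≠ 0) :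
    WeakLefschetz (Ideal.span (Set.range f)) := by
  have hf0 : f 0 ≠ 0 := ne_zero_of_radical_span_range_eq hI
  have hne : dehom K (f 0) ≠ 0 := fun h => hf0 (dehom_eq_zero (hf 0) h)
  have hrel := isRelPrime_dehom hf hI
  have hlc : (gen K (f 0)).coeff (d 0) ≠ 0 := by
    intro h
    rw [← coeff_res_zero_zero (hf 0), ← map_gen, Polynomial.coeff_map, h, map_zero] at heval
    exact heval rfl
  have hlead : (gen K (f 0)).natDegree = d 0 :=
    le_antisymm (natDegree_gen_le (hf 0)) (Polynomial.le_natDegree_of_ne_zero hlc)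
  have hgen0 : gen K (f 0) ≠ 0 := by
    intro h
    rw [h, Polynomial.coeff_zero] at hlc
    exact hlc rfl
  obtain ⟨A, B, δ, hδ, hAB⟩ := exists_mul_add_mul_eq_C_of_isRelPrime hgen0 (isRelPrime_gen hne hrel)
  have hcop : ∀ a b : K, eval ![a, b] δ ≠ 0 → IsCoprime (res a b (f 0)) (res a b (f 1)) := by
    intro a b hab
    have h1 := congrArg (Polynomial.map (eval ![a, b])) hAB
    simp only [Polynomial.map_add, Polynomial.map_mul, map_gen, Polynomial.map_C] at h1
    have h2 : Polynomial.C (eval ![a, b] δ)⁻¹ * Polynomial.C (eval ![a, b] δ) = 1 := by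
      rw [← Polynomial.C_mul, inv_mul_cancel₀ hab, Polynomial.C_1]
    refine ⟨Polynomial.C (eval ![a, b] δ)⁻¹ * A.map (eval ![a, b]),
      Polynomial.C (eval ![a, b] δ)⁻¹ * B.map (eval ![a, b]), ?_⟩
    linear_combination Polynomial.C (eval ![a, b] δ)⁻¹ * h1 + h2
  have hdeg : ∀ a b : K, eval ![a, b] ((gen K (f 0)).coeff (d 0)) ≠ 0 →
      (res a b (f 0)).natDegree = d 0 := by
    intro a b hab
    refine le_antisymm (natDegree_res_le (hf 0) a b) (Polynomial.le_natDegree_of_ne_zero ?_)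
    rwa [← map_gen, Polynomial.coeff_map]
  have hres0 : ∀ a b : K, (res a b (f 0)).natDegree = d 0 → res a b (f 0) ≠ 0 := by
    intro a b hab h
    rw [h, Polynomial.natDegree_zero] at hab
    exact (hd 0).ne hab
  obtain ⟨a₀, b₀, hab₀⟩ := exists_eval_ne_zero (mul_ne_zero hδ hlc)
  rw [map_mul] at hab₀
  have hcop₀ := hcop a₀ b₀ (left_ne_zero_of_mul hab₀)
  have hdeg₀ := hdeg a₀ b₀ (right_ne_zero_of_mul hab₀)
  rcases le_or_gt (d 0 + d 1) (d 2 + 1) with hcase | hcase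
  · refine ⟨lin a₀ b₀, lin_ne_zero _ _, isHomogeneous_lin _ _, fun m => ?_⟩
    by_cases hm : m + 3 ≤ d 0 + d 1
    · left
      exact lefInj_of_syzygyFree hf
        (syzygyFree_of_isCoprime (p := fun i => res a₀ b₀ (f i)) hcop₀ hdeg₀ (hres0 _ _ hdeg₀)
          (by omega) (by omega))
    · right
      have h0 := hd 0
      refine lefSurj_of_spansDegree hf ((spansDegree_of_isCoprime
        (p := fun i => res a₀ b₀ (f i)) hcop₀ hdeg₀ (natDegree_res_le (hf 1) _ _) (hd 0)
        (n := d 0 + d 1 - 1) (by omega)).mono (by omega))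
  · obtain ⟨e, he⟩ : ∃ e, e + 1 = (d 0 + d 1 + d 2) / 2 :=
      ⟨(d 0 + d 1 + d 2) / 2 - 1, by omega⟩
    have hgenfree : ∀ g : Fin 3 → Polynomial (MvPolynomial (Fin 2) K),
        (∀ i, g i ∈ Polynomial.degreeLT _ (e + 1 - d i)) →
        ∑ i, g i * gen K (f i) = 0 → ∀ i, g i = 0 := by
      intro g hg hsum
      refine eq_zero_of_gen_syzygy hf hne hrel
        (fun n H hH hmem => mem_span_pair_of_mul_mem hf hI hcop₀ (hres0 _ _ hdeg₀) hdeg₀ hH hmem)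
        hlead (hd 0) (e := e) (by omega) (by omega) (by omega) (by omega) (fun i => ?_) hsum
      refine or_iff_not_imp_left.mpr fun h0 => ?_
      have := Polynomial.mem_degreeLT.mp (hg i)
      rw [← Polynomial.natDegree_lt_iff_degree_lt h0] at this
      omega
    obtain ⟨δ', hδ', hspec⟩ := exists_forall_map_syzygy_eq_zero (fun i => gen K (f i))
      (fun i => e + 1 - d i) hgenfree
    obtain ⟨a, b, hab⟩ := exists_eval_ne_zero (mul_ne_zero (mul_ne_zero hδ hlc) hδ')
    rw [map_mul, map_mul] at hab
    have hdeg' := hdeg a b (right_ne_zero_of_mul (left_ne_zero_of_mul hab))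
    have hcop' := hcop a b (left_ne_zero_of_mul (left_ne_zero_of_mul hab))
    have hfree : SyzygyFree (fun i => res a b (f i)) d e := by
      intro q hq hsum
      refine hspec (eval ![a, b]) (right_ne_zero_of_mul hab) q hq ?_
      simpa only [map_gen] using hsum
    refine ⟨lin a b, lin_ne_zero _ _, isHomogeneous_lin _ _, fun m => ?_⟩
    by_cases hm : m + 1 ≤ e
    · exact Or.inl (lefInj_of_syzygyFree hf (hfree.mono hm))
    · right
      refine lefSurj_of_spansDegree hf (SpansDegree.mono (m := e + 1) ?_ (by omega))
      rcases Nat.even_or_odd' (d 0 + d 1 + d 2) with ⟨k, hk | hk⟩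
      · refine (hfree.spansDegree (fun i => natDegree_res_le (hf i) a b) ?_).succ
        rw [Fin.sum_univ_three]
        omega
      · refine hfree.spansDegree_succ (fun i => natDegree_res_le (hf i) a b) hcop' hdeg' (hd 0)
          (by omega) (by omega) (by omega) ?_
        rw [Fin.sum_univ_three]
        omega

/-- The shear `X i ↦ X i + c i * X 0` for `i = 1, 2`, fixing `X 0`. -/
noncomputable def shear (b c : K) : MvPolynomial (Fin 3) K →ₐ[K] MvPolynomial (Fin 3) K :=
  aeval ![X 0, X 1 + C b * X 0, X 2 + C c * X 0]

lemma shear_comp_shear_neg (b c : K) : (shear b c).comp (shear (-b) (-c)) = AlgHom.id K _ := by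
  ext i : 1
  fin_cases i <;> simp [shear, algHom_C, -MvPolynomial.algebraMap_apply, algebraMap_eq]

/-- The shear as an automorphism. -/
noncomputable def shearEquiv (b c : K) : MvPolynomial (Fin 3) K ≃ₐ[K] MvPolynomial (Fin 3) K :=
  AlgEquiv.ofAlgHom (shear b c) (shear (-b) (-c)) (shear_comp_shear_neg b c)
    (by simpa using shear_comp_shear_neg (-b) (-c))

lemma isHomogeneous_shear (b c : K) {F : MvPolynomial (Fin 3) K} {n : ℕ} (hF : F.IsHomogeneous n) :
    (shear b c F).IsHomogeneous n := by
  have hlin : ∀ (t : K) (i : Fin 3), (C t * X i : MvPolynomial (Fin 3) K).IsHomogeneous 1 :=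
    fun t i => by simpa using (isHomogeneous_C (Fin 3) t).mul (isHomogeneous_X K i)
  have := IsHomogeneous.aeval (n := 1) hF
    (![X 0, X 1 + C b * X 0, X 2 + C c * X 0] : Fin 3 → MvPolynomial (Fin 3) K) (by
    intro i
    fin_cases i
    · exact isHomogeneous_X K 0
    · exact (isHomogeneous_X K 1).add (hlin b 0)
    · exact (isHomogeneous_X K 2).add (hlin c 0))
  rwa [one_mul] at this

lemma constantCoeff_comp_shear (b c : K) :
    (constantCoeff : MvPolynomial (Fin 3) K →+* K).comp
      (shear b c : MvPolynomial (Fin 3) K →+* MvPolynomial (Fin 3) K) = constantCoeff := by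
  ext i
  · simp
  · fin_cases i <;> simp [shear]

lemma eval_shear (b c : K) (F : MvPolynomial (Fin 3) K) :
    eval ![1, 0, 0] (shear b c F) = eval ![1, b, c] F := by
  have h : (eval ![1, 0, 0]).comp (shear b c : MvPolynomial (Fin 3) K →+* _) = eval ![1, b, c] := by
    ext i
    · simp
    · fin_cases i <;> simp [shear]
  exact DFunLike.congr_fun h F

lemma weakLefschetz_of_comap (σ : MvPolynomial (Fin 3) K ≃ₐ[K] MvPolynomial (Fin 3) K)
    (hσ : ∀ (n : ℕ) (F : MvPolynomial (Fin 3) K), F.IsHomogeneous n → (σ F).IsHomogeneous n)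
    (hσ' : ∀ (n : ℕ) (F : MvPolynomial (Fin 3) K), F.IsHomogeneous n → (σ.symm F).IsHomogeneous n)
    {I : Ideal (MvPolynomial (Fin 3) K)} (h : WeakLefschetz (I.comap σ.symm)) :
    WeakLefschetz I := by
  obtain ⟨ℓ, hℓ0, hℓ, hm⟩ := h
  refine ⟨σ.symm ℓ, by simpa using hℓ0, hσ' _ _ hℓ, fun m => (hm m).imp ?_ ?_⟩
  · intro hinj g hg hmem
    have := hinj (σ g) (hσ _ _ hg) (by simpa [Ideal.mem_comap] using hmem)
    simpa [Ideal.mem_comap] using this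
  · intro hsurj g hg
    obtain ⟨q, hq, hmem⟩ := hsurj (σ g) (hσ _ _ hg)
    exact ⟨σ.symm q, hσ' _ _ hq, by simpa [Ideal.mem_comap] using hmem⟩

lemma exists_eval_one_ne_zero [Infinite K] {F : MvPolynomial (Fin 3) K} {n : ℕ}
    (hF : F.IsHomogeneous n) (hF0 : F ≠ 0) : ∃ b c : K, eval ![1, b, c] F ≠ 0 := by
  by_contra! h
  refine hF0 (eq_zero_of_forall_eval_of_apply_eq_one hF 0 fun p hp => ?_)
  rw [← h (p 1) (p 2)]
  congr 2
  funext i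
  fin_cases i
  exacts [hp, rfl, rfl]

end Lefschetz

/-- **Every Artinian complete intersection in `K[X,Y,Z]` has the Weak Lefschetz
property** (char `K = 0`, `K` algebraically closed): if `f₁, f₂, f₃` are homogeneous
of positive degrees and the ideal `I = (f₁,f₂,f₃)` is `R₊`-primary (i.e. its radical
is the irrelevant maximal ideal `(X,Y,Z)`), then `A = R/I` has WLP. -/
theorem artinian_complete_intersection_weakLefschetz
    {K : Type*} [Field K] [IsAlgClosed K] [CharZero K]
    (f : Fin 3 → MvPolynomial (Fin 3) K) (d : Fin 3 → ℕ)
    (hd : ∀ i, 0 < d i) (hf : ∀ i, (f i).IsHomogeneous (d i))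
    (hprimary : (Ideal.span (Set.range f)).radical =
      Ideal.span {X 0, X 1, X 2}) :
    WeakLefschetz (Ideal.span (Set.range f)) := by
  rw [MvPolynomial.span_X_eq_ker_constantCoeff] at hprimary
  obtain ⟨i, -, hi⟩ := Finset.exists_max_image Finset.univ d Finset.univ_nonempty
  let τ : Equiv.Perm (Fin 3) := Equiv.swap i 2
  have hτ : ∀ j, d (τ j) ≤ d (τ 2) := fun j => by
    rw [Equiv.swap_apply_right]
    exact hi _ (Finset.mem_univ _)
  have hrange : Set.range (f ∘ τ) = Set.range f := τ.surjective.range_comp f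
  rw [← hrange] at hprimary ⊢
  obtain ⟨b, c, hbc⟩ := exists_eval_one_ne_zero (hf (τ 0)) (ne_zero_of_radical_span_range_eq hprimary)
  have hspan : (Ideal.span (Set.range (f ∘ τ))).comap (shearEquiv b c).symm =
      Ideal.span (Set.range fun j => shear b c (f (τ j))) := by
    have h1 := Ideal.comap_symm (I := Ideal.span (Set.range (f ∘ τ)))
      (shearEquiv b c : MvPolynomial (Fin 3) K ≃+* MvPolynomial (Fin 3) K)
    refine h1.trans ?_
    rw [Ideal.map_span, ← Set.range_comp]
    rfl
  refine weakLefschetz_of_comap (shearEquiv b c) (fun n F hF => isHomogeneous_shear b c hF)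
    (fun n F hF => isHomogeneous_shear (-b) (-c) hF) ?_
  have hrad : ((Ideal.span (Set.range (f ∘ τ))).comap (shearEquiv b c).symm).radical =
      RingHom.ker (constantCoeff : MvPolynomial (Fin 3) K →+* K) := by
    rw [← Ideal.comap_radical, hprimary]
    ext F
    exact iff_of_eq (congrArg (· = 0) (DFunLike.congr_fun (constantCoeff_comp_shear (-b) (-c)) F))
  rw [hspan] at hrad ⊢
  exact weakLefschetz_of_eval_ne_zero (fun j => hd (τ j))
    (fun j => isHomogeneous_shear b c (hf (τ j))) hrad (hτ 0) (hτ 1)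
    (by rw [eval_shear]; exact hbc)
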